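/- arXiv:2011.10816 — 2 statements merged into one kernel-verified Lean document; each statement's English description precedes it below -/
import Mathlib

section
/- Under the Geometry hypothesis, let H_𝒢 be the closure in L²(ℱ) of the set of restrictions to ℱ of functions that are harmonic on 𝒢 and square-integrable on 𝒢, and let Π denote the orthogonal projection of L²(ℱ) onto H_𝒢. Then every function h that is harmonic on 𝒦 = ℝ² ∖ closure(𝒪), locally square-integrable on 𝒦, with h(x) → 0 as |x| → ∞, satisfies ‖Π(h|_ℱ)‖_{L²(ℱ)} ≤ 2√(δ_0/δ) · ‖h‖_{L²(ℱ)}. (Lemma 3.5 of the paper.) -/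
open MeasureTheory Metric Filter

noncomputable section

abbrev Pt := EuclideanSpace ℝ (Fin 2)

/-- The Laplacian of `f : ℝ² → ℝ` at `x`, as the sum of the pure second derivatives. -/
def lap (f : Pt → ℝ) (x : Pt) : ℝ :=
  ∑ i : Fin 2, iteratedFDeriv ℝ 2 f x (fun _ => EuclideanSpace.single i (1 : ℝ))

/-- A function is harmonic on an open set `U ⊆ ℝ²` if it is `C²` on `U` and its Laplacian
vanishes on `U`. -/
def IsHarmonicOn (f : Pt → ℝ) (U : Set Pt) : Prop :=
  ContDiffOn ℝ 2 f U ∧ ∀ x ∈ U, lap f x = 0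

/-- Hypothesis 3.1 of the paper (the "Geometry" hypothesis).  The smoothness of the
boundaries plays no role in the estimates and is not recorded. -/
structure Geometry (𝒢 𝒪 : Set Pt) (c : Pt) (Re Ri Rp Rm δ δ₀ : ℝ) : Prop where
  openG : IsOpen 𝒢
  openO : IsOpen 𝒪
  bddG : Bornology.IsBounded 𝒢
  bddO : Bornology.IsBounded 𝒪
  scG : SimplyConnectedSpace 𝒢
  scO : SimplyConnectedSpace 𝒪
  clO_sub_G : closure 𝒪 ⊆ 𝒢
  Rm_pos : 0 < Rm
  Rm_lt_Rp : Rm < Rp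
  Rp_lt_Ri : Rp < Ri
  Ri_lt_Re : Ri < Re
  clG_sub : closure 𝒢 ⊆ ball c Re
  clDi_sub : closedBall c Ri ⊆ 𝒢
  clDp_sub : closedBall c Rp ⊆ ball c Ri
  clDm_sub : closedBall c Rm ⊆ ball c Rp
  clO_sub : closure 𝒪 ⊆ ball c Rm
  Rm_eq : Rm = Re * Real.exp (-δ ^ 2)
  Rp_eq : Rp = Re * Real.exp (-δ)
  δ₀_eq : δ₀ = 2 + Real.log (Re / Ri)
  δ₀_lt_δ : δ₀ < δ

/-- The closure in `L²(ℱ)` of the set of (classes of) restrictions to `ℱ` of functions that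
are harmonic on `𝒢` and square-integrable on `𝒢`. -/
def HGclosure (𝒢 ℱ : Set Pt) : Submodule ℝ (Lp ℝ 2 (volume.restrict ℱ)) :=
  (Submodule.span ℝ {f : Lp ℝ 2 (volume.restrict ℱ) |
      ∃ g : Pt → ℝ, IsHarmonicOn g 𝒢 ∧ IntegrableOn (fun x => g x ^ 2) 𝒢 ∧
        (f : Pt → ℝ) =ᵐ[volume.restrict ℱ] g}).topologicalClosure

instance (𝒢 ℱ : Set Pt) : CompleteSpace (HGclosure 𝒢 ℱ) :=
  (Submodule.isClosed_topologicalClosure _).completeSpace_coe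


section CA
open Real Complex InnerProductSpace Topology

lemma circ_ci {E : Type*} [NormedAddCommGroup E] {f : ℂ → E} {r : ℝ} (hr : 0 ≤ r)
    (hf : ContinuousOn f (sphere 0 r)) : CircleIntegrable f 0 r :=
  ContinuousOn.circleIntegrable hr hf

/-- circular `L²` means of holomorphic functions are nondecreasing in the radius -/
lemma mono_avg {p : ℂ → ℂ} {R r₁ r₂ : ℝ} (hp : DifferentiableOn ℂ p (ball 0 R))
    (h0 : 0 ≤ r₁) (h12 : r₁ ≤ r₂) (h2 : r₂ < R) :
    circleAverage (fun z => ‖p z‖ ^ 2) 0 r₁ ≤ circleAverage (fun z => ‖p z‖ ^ 2) 0 r₂ := by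
  have hpc : ContinuousOn p (ball 0 R) := hp.continuousOn
  have hdc : ContinuousOn (deriv p) (ball 0 R) := (hp.deriv isOpen_ball).continuousOn
  have hcurve : ∀ z ∈ ball (0:ℂ) R, ∀ θ : ℝ, z * cexp (θ * I) ∈ ball (0:ℂ) R := by
    intro z hz θ
    simpa [Complex.norm_exp_ofReal_mul_I] using hz
  have hcont : ∀ (q : ℂ → ℂ), ContinuousOn q (ball 0 R) → ∀ z ∈ ball (0:ℂ) R,
      Continuous (fun θ : ℝ => q (z * cexp (θ * I))) := by
    intro q hq z hz
    exact hq.comp_continuous (by fun_prop) (hcurve z hz)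
  have hr1 : (r₁ : ℂ) ∈ ball (0:ℂ) R := by
    simp [abs_of_nonneg h0]; linarith
  set Φ : ℂ → ℂ := fun z => ∫ θ in (0:ℝ)..2 * π,
    (starRingEnd ℂ) (p (r₁ * cexp (θ * I))) * p (z * cexp (θ * I)) with hΦ
  have hconj : Continuous (fun θ : ℝ => (starRingEnd ℂ) (p (r₁ * cexp (θ * I)))) :=
    Complex.continuous_conj.comp (hcont p hpc _ hr1)
  have hΦd : DifferentiableOn ℂ Φ (ball 0 R) := by
    intro z₀ hz₀
    have hz₀' : ‖z₀‖ < R := by simpa using hz₀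
    set ρ := (‖z₀‖ + R) / 2
    have hρR : closedBall (0:ℂ) ρ ⊆ ball 0 R := closedBall_subset_ball (by simp only [ρ]; linarith)
    obtain ⟨C, hC⟩ := (isCompact_closedBall (0:ℂ) ρ).exists_bound_of_continuousOn (hdc.mono hρR)
    obtain ⟨C', hC'⟩ := (isCompact_closedBall (0:ℂ) ρ).exists_bound_of_continuousOn (hpc.mono hρR)
    obtain ⟨C'', hC''⟩ := (isCompact_Icc (a := (0:ℝ)) (b := 2 * π)).exists_bound_of_continuousOn
      hconj.continuousOn
    have hnb : ball (0:ℂ) ρ ∈ 𝓝 z₀ := isOpen_ball.mem_nhds (by simp [ρ]; linarith)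
    have key := intervalIntegral.hasDerivAt_integral_of_dominated_loc_of_deriv_le
      (μ := volume) (a := 0) (b := 2 * π)
      (F := fun z (θ : ℝ) => (starRingEnd ℂ) (p (r₁ * cexp (θ * I))) * p (z * cexp (θ * I)))
      (F' := fun z (θ : ℝ) => (starRingEnd ℂ) (p (r₁ * cexp (θ * I))) *
        (deriv p (z * cexp (θ * I)) * cexp (θ * I)))
      (x₀ := z₀) (s := ball 0 ρ) (bound := fun _ => C'' * C) hnb ?_ ?_ ?_ ?_ ?_ ?_
    · exact key.2.differentiableAt.differentiableWithinAt
    · filter_upwards [isOpen_ball.mem_nhds hz₀] with z hz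
      exact (hconj.mul (hcont p hpc z hz)).aestronglyMeasurable
    · exact (hconj.mul (hcont p hpc z₀ hz₀)).intervalIntegrable _ _
    · exact (hconj.mul ((hcont _ hdc z₀ hz₀).mul (by fun_prop))).aestronglyMeasurable
    · refine ae_of_all _ fun θ hθ z hz => ?_
      rw [Set.uIoc_of_le (by positivity)] at hθ
      have e1 := hC'' θ ⟨hθ.1.le, hθ.2⟩
      have e2 := hC (z * cexp (θ * I)) (by
        simp only [mem_ball, dist_zero_right] at hz
        simp [Complex.norm_exp_ofReal_mul_I]; exact hz.le)
      rw [norm_mul, norm_mul, Complex.norm_exp_ofReal_mul_I, mul_one]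
      gcongr
      exact (norm_nonneg _).trans e1
    · exact intervalIntegrable_const
    · refine ae_of_all _ fun θ hθ z hz => ?_
      have hz' : z * cexp (θ * I) ∈ ball (0:ℂ) R := hcurve z (hρR (ball_subset_closedBall hz)) θ
      have hd : HasDerivAt p (deriv p (z * cexp (θ * I))) (z * cexp (θ * I)) :=
        (hp.differentiableAt (isOpen_ball.mem_nhds hz')).hasDerivAt
      have := hd.comp z ((hasDerivAt_id z).mul_const (cexp (θ * I)))
      simpa using! this.const_mul _
  set m : ℂ → ℝ := fun z => ∫ θ in (0:ℝ)..2 * π, ‖p (z * cexp (θ * I))‖ ^ 2 with hm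
  have hmr : ∀ r : ℝ, circleAverage (fun z => ‖p z‖ ^ 2) 0 r = (2 * π)⁻¹ * m r := by
    intro r
    simp [circleAverage_def, hm, circleMap]
  have hrot : ∀ z : ℂ, m z = m ‖z‖ := by
    intro z
    have h1 := circleAverage_eq_integral_add (f := fun z => ‖p z‖ ^ 2) (c := 0) (R := ‖z‖) z.arg
    rw [hmr] at h1
    have : (0:ℝ) < (2 * π)⁻¹ := by positivity
    rw [smul_eq_mul] at h1
    have h2 := mul_left_cancel₀ this.ne' h1
    rw [h2]
    simp only [hm]
    congr 1
    ext θ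
    simp only [circleMap, zero_add]
    have : z * cexp (θ * I) = ‖z‖ * cexp ((↑(θ + z.arg) : ℂ) * I) := by
      conv_lhs => rw [← Complex.norm_mul_exp_arg_mul_I z]
      rw [mul_assoc, ← Complex.exp_add]
      push_cast
      ring_nf
    rw [this]
  have hbd : ∀ z ∈ ball (0:ℂ) R, ‖Φ z‖ ≤ (m r₁ + m ‖z‖) / 2 := by
    intro z hz
    rw [← hrot z]
    have c1 := hcont p hpc _ hr1
    have c2 := hcont p hpc z hz
    calc ‖Φ z‖ ≤ ∫ θ in (0:ℝ)..2 * π, (‖p (r₁ * cexp (θ * I))‖ ^ 2 + ‖p (z * cexp (θ * I))‖ ^ 2) / 2 := by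
          apply intervalIntegral.norm_integral_le_of_norm_le (by positivity)
          · refine ae_of_all _ fun θ _ => ?_
            rw [norm_mul, RCLike.norm_conj]
            nlinarith [sq_nonneg (‖p (r₁ * cexp (θ * I))‖ - ‖p (z * cexp (θ * I))‖)]
          · exact (((c1.norm.pow 2).add (c2.norm.pow 2)).div_const 2).intervalIntegrable _ _
      _ = _ := by
          rw [intervalIntegral.integral_div, intervalIntegral.integral_add]
          · exact (c1.norm.pow 2).intervalIntegrable _ _
          · exact (c2.norm.pow 2).intervalIntegrable _ _
  have hΦ1 : Φ r₁ = (m r₁ : ℂ) := by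
    simp only [hΦ, hm]
    rw [← intervalIntegral.integral_ofReal]
    congr 1
    ext θ
    rw [mul_comm, Complex.mul_conj, Complex.normSq_eq_norm_sq]
  rcases eq_or_lt_of_le (h0.trans h12) with h | h
  · have : r₁ = r₂ := by linarith
    rw [this]
  have hle : ‖Φ r₁‖ ≤ (m r₁ + m r₂) / 2 := by
    apply Complex.norm_le_of_forall_mem_frontier_norm_le (U := ball 0 r₂) isBounded_ball
    · exact (hΦd.mono (by rw [closure_ball _ h.ne']; exact closedBall_subset_ball h2)).diffContOnCl
    · intro z hz
      rw [frontier_ball _ h.ne'] at hz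
      have hz' : ‖z‖ = r₂ := by simpa using hz
      have := hbd z (by simp [hz', h2])
      rwa [hz'] at this
    · rw [closure_ball _ h.ne']
      simp [abs_of_nonneg h0, h12]
  rw [hΦ1, Complex.norm_real] at hle
  have := (le_abs_self _).trans hle
  rw [hmr, hmr]
  gcongr
  linarith

lemma avg_re_sq {f : ℂ → ℂ} {R r : ℝ} (hf : DifferentiableOn ℂ f (ball 0 R))
    (h0 : 0 ≤ r) (h2 : r < R) :
    circleAverage (fun z => (f z).re ^ 2) 0 r =
      circleAverage (fun z => ‖f z‖ ^ 2) 0 r / 2 + (f 0 ^ 2).re / 2 := by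
  have hsub : closedBall (0:ℂ) r ⊆ ball 0 R := closedBall_subset_ball h2
  have hc : ContinuousOn f (sphere 0 r) := hf.continuousOn.mono (sphere_subset_closedBall.trans hsub)
  have hmv : circleAverage (fun z => f z ^ 2) 0 r = f 0 ^ 2 := by
    apply DiffContOnCl.circleAverage
    rw [abs_of_nonneg h0]
    exact ((hf.pow 2).mono (closure_ball_subset_closedBall.trans hsub)).diffContOnCl
  have hre : circleAverage (fun z => (f z ^ 2).re) 0 r = (f 0 ^ 2).re := by
    rw [← hmv]
    exact (Complex.reCLM.circleAverage_comp_comm (circ_ci h0 (hc.pow 2)))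
  have e : (fun z => (f z).re ^ 2) = fun z => ((1/2:ℝ) • ‖f z‖ ^ 2) + (1/2:ℝ) • (f z ^ 2).re := by
    ext z
    rw [← Complex.normSq_eq_norm_sq, Complex.normSq_apply, pow_two (f z), Complex.mul_re]
    simp; ring
  rw [e, circleAverage_fun_add, circleAverage_fun_smul, circleAverage_fun_smul, hre]
  · simp; ring
  · exact circ_ci h0 (by fun_prop)
  · exact circ_ci h0 (by
      have : ContinuousOn (fun z => (f z ^ 2).re) (sphere 0 r) :=
        Complex.continuous_re.comp_continuousOn (hc.pow 2)
      exact this.const_smul (1/2:ℝ))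

lemma int_mono {g : ℂ → ℝ} {R r₁ r₂ : ℝ} (hg : HarmonicOnNhd g (ball 0 R))
    (h0 : 0 ≤ r₁) (h12 : r₁ ≤ r₂) (h2 : r₂ < R) :
    circleAverage (fun z => g z ^ 2) 0 r₁ ≤ circleAverage (fun z => g z ^ 2) 0 r₂ := by
  obtain ⟨F, hF, hFg⟩ := hg.exists_analyticOnNhd_ball_re_eq
  have hd : DifferentiableOn ℂ F (ball 0 R) := hF.differentiableOn
  have e : ∀ r, 0 ≤ r → r < R → circleAverage (fun z => g z ^ 2) 0 r =
      circleAverage (fun z => (F z).re ^ 2) 0 r := by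
    intro r h0 hr
    apply circleAverage_congr_sphere
    intro z hz
    have : z ∈ ball (0:ℂ) R := by
      rw [abs_of_nonneg h0] at hz
      have : ‖z‖ = r := by simpa using hz
      simp [this, hr]
    simp only [← hFg this]
  rw [e _ h0 (h12.trans_lt h2), e _ (h0.trans h12) h2, avg_re_sq hd h0 (h12.trans_lt h2),
    avg_re_sq hd (h0.trans h12) h2]
  linarith [mono_avg hd h0 h12 h2]

/-- gradient estimate -/
lemma grad_est {h : ℂ → ℝ} {z : ℂ} {R ε : ℝ} (hR : 0 < R) (hε : 0 < ε)
    (hh : HarmonicOnNhd h (ball z R)) (hb : ∀ w ∈ ball z R, |h w| ≤ ε) :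
    ‖(fderiv ℝ h z 1 : ℂ) - I * fderiv ℝ h z I‖ ≤ 8 * ε / R := by
  obtain ⟨F, hF, hFg⟩ := hh.exists_analyticOnNhd_ball_re_eq
  have hd : DifferentiableOn ℂ F (ball z R) := hF.differentiableOn
  have hz : z ∈ ball z R := mem_ball_self hR
  have hFz : HasDerivAt F (deriv F z) z := (hd.differentiableAt (isOpen_ball.mem_nhds hz)).hasDerivAt
  have hderiv : (fderiv ℝ h z 1 : ℂ) - I * fderiv ℝ h z I = deriv F z := by
    have h1 : HasFDerivAt (fun w => (F w).re) _ z :=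
      Complex.reCLM.hasFDerivAt.comp z (hFz.hasFDerivAt.restrictScalars ℝ)
    have h2 : (fun w => (F w).re) =ᶠ[𝓝 z] h := by
      filter_upwards [isOpen_ball.mem_nhds hz] with w hw using hFg hw
    have h3 := (h1.congr_of_eventuallyEq h2.symm).fderiv
    rw [h3]
    apply Complex.ext <;> simp
  rw [hderiv]
  have hbc : ∀ w ∈ ball (0:ℂ) R, ‖F (z + w) - F z‖ ≤ 2 * (2 * ε) * ‖w‖ / (R - ‖w‖) := by
    intro w hw
    have hmap : Set.MapsTo (fun w => z + w) (ball (0:ℂ) R) (ball z R) := by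
      intro w hw; simpa using hw
    apply Complex.borelCaratheodory_zero (f := fun w => F (z + w) - F z) (by positivity)
      ((hd.comp (by fun_prop) hmap).sub_const _) _ hR hw (by simp)
    intro w hw
    have a1 := hb _ (hmap hw)
    have a2 := hb _ hz
    rw [← hFg (hmap hw)] at a1
    rw [← hFg hz] at a2
    simp only [Set.mem_ofPred_eq, sub_re]
    have := abs_le.1 a1; have := abs_le.1 a2
    linarith
  have := Complex.norm_deriv_le_of_forall_mem_sphere_norm_le (f := fun w => F w - F z) (c := z)
    (R := R / 2) (C := 4 * ε) (by positivity) ?_ ?_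
  · rw [deriv_sub_const] at this
    refine this.trans_eq ?_
    field_simp; ring
  · exact ((hd.sub_const _).mono (closure_ball_subset_closedBall.trans
      (closedBall_subset_ball (by linarith)))).diffContOnCl
  · intro w hw
    have hw' : ‖w - z‖ = R / 2 := by simpa [dist_eq_norm] using hw
    have := hbc (w - z) (by simp [hw']; linarith)
    rw [hw', add_sub_cancel] at this
    refine this.trans_eq ?_
    field_simp; ring

lemma ext_rep {h : ℂ → ℝ} {a : ℝ} (ha : 0 < a) (hh : HarmonicOnNhd h {z | a < ‖z‖})
    (hlim : Tendsto h (cocompact ℂ) (𝓝 0)) :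
    ∃ f : ℂ → ℂ, DifferentiableOn ℂ f (ball 0 a⁻¹) ∧ f 0 = 0 ∧
      ∀ z, a < ‖z‖ → h z = (f z⁻¹).re := by
  set H : ℂ → ℂ := fun z => (fderiv ℝ h z 1 : ℂ) - I * fderiv ℝ h z I with hH
  have hHd : ∀ z, a < ‖z‖ → DifferentiableAt ℂ H z := fun z hz =>
    HarmonicAt.differentiableAt_complex_partial (hh z hz)
  have hinv : ∀ w ∈ ball (0:ℂ) a⁻¹, w ≠ 0 → a < ‖w⁻¹‖ := by
    intro w hw hw0
    have hw1 : ‖w‖ < a⁻¹ := by simpa using hw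
    rw [norm_inv]
    exact (lt_inv_comm₀ (norm_pos_iff.2 hw0) ha).1 hw1
  have hinv' : ∀ z, a < ‖z‖ → z⁻¹ ∈ ball (0:ℂ) a⁻¹ := by
    intro z hz
    simp only [mem_ball, dist_zero_right, norm_inv]
    gcongr
  set φ : ℂ → ℂ := fun w => H w⁻¹ / w with hφ
  have hφ0 : φ 0 = 0 := by simp [hφ]
  have hnb : ball (0:ℂ) a⁻¹ ∈ 𝓝 (0:ℂ) := ball_mem_nhds _ (by positivity)
  have hφc : ContinuousAt φ 0 := by
    rw [Metric.continuousAt_iff]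
    intro ε hε
    have hev := hlim.eventually (Metric.closedBall_mem_nhds (0:ℝ) (show 0 < ε / 32 by positivity))
    obtain ⟨B, hB⟩ := (Metric.closedBall_compl_subset_of_mem_cocompact hev 0)
    set B' := max B a
    have hB' : 0 < B' := ha.trans_le (le_max_right _ _)
    refine ⟨(2 * B')⁻¹, by positivity, fun {w} hw => ?_⟩
    rw [hφ0, dist_zero_right]
    rw [dist_zero_right] at hw
    by_cases hw0 : w = 0
    · simp [hw0, hφ0, hε]
    have hwp : 0 < ‖w‖ := norm_pos_iff.2 hw0
    have hz : 2 * B' < ‖w⁻¹‖ := by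
      rw [norm_inv]
      exact (lt_inv_comm₀ hwp (by positivity)).1 hw
    set z := w⁻¹
    have hball : ∀ u ∈ ball z (‖z‖ / 2), B' < ‖u‖ := by
      intro u hu
      have h1 : ‖u - z‖ < ‖z‖ / 2 := by simpa [dist_eq_norm] using hu
      have h2 : ‖z‖ ≤ ‖u‖ + ‖u - z‖ := by
        have := norm_sub_le u (u - z); simpa using this
      linarith
    have := grad_est (h := h) (z := z) (R := ‖z‖ / 2) (ε := ε / 32) (by linarith) (by positivity)
      (fun u hu => hh u ((le_max_right _ _).trans_lt (hball u hu)))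
      (fun u hu => by
        have : u ∈ (closedBall (0:ℂ) B)ᶜ := by
          simp; exact (le_max_left _ _).trans_lt (hball u hu)
        simpa using hB this)
    have hzw : ‖z‖ = ‖w‖⁻¹ := norm_inv w
    have e : ‖φ w‖ = ‖H z‖ * ‖z‖ := by
      simp only [hφ, norm_div]; rw [hzw, div_eq_mul_inv]
    have hzp : 0 < ‖z‖ := by linarith
    rw [e]
    calc ‖H z‖ * ‖z‖ ≤ (8 * (ε / 32) / (‖z‖ / 2)) * ‖z‖ := by gcongr
      _ = ε / 2 := by field_simp; ring
      _ < ε := by linarith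
  have hφd : DifferentiableOn ℂ φ (ball 0 a⁻¹) := by
    rw [← Complex.differentiableOn_compl_singleton_and_continuousAt_iff hnb]
    refine ⟨?_, hφc⟩
    rintro w ⟨hw, hw0⟩
    have hw0 : w ≠ 0 := hw0
    have h1 : DifferentiableAt ℂ (fun w => H w⁻¹) w :=
      (hHd _ (hinv w hw hw0)).comp w (differentiableAt_inv hw0)
    exact (h1.div differentiableAt_id hw0).differentiableWithinAt
  have hψ : DifferentiableOn ℂ (dslope φ 0) (ball 0 a⁻¹) :=
    (Complex.differentiableOn_dslope hnb).2 hφd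
  obtain ⟨f, hf0, hf⟩ := hψ.neg.isExactOn_ball.with_val_at 0 0
  refine ⟨f, fun w hw => (hf w hw).differentiableAt.differentiableWithinAt, hf0, ?_⟩
  have hD : ∀ z, a < ‖z‖ → HasFDerivAt (fun z => h z - (f z⁻¹).re) (0 : ℂ →L[ℝ] ℝ) z := by
    intro z hz
    have hz0 : z ≠ 0 := by
      rintro rfl; simp at hz; linarith
    have h1 : HasDerivAt (fun z => f z⁻¹) (H z) z := by
      have := (hf _ (hinv' z hz)).comp z (hasDerivAt_inv hz0)
      convert! this using 1
      rw [Pi.neg_apply, dslope_of_ne _ (inv_ne_zero hz0), slope_def_field, hφ0]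
      simp only [hφ, inv_inv]
      field_simp
      ring
    have h2 : HasFDerivAt (fun w => (f w⁻¹).re) _ z :=
      Complex.reCLM.hasFDerivAt.comp z (h1.hasFDerivAt.restrictScalars ℝ)
    have h3 : HasFDerivAt h (fderiv ℝ h z) z :=
      ((hh z hz).1.differentiableAt two_ne_zero).hasFDerivAt
    convert! h3.sub h2 using 1
    ext v
    nth_rw 2 [(by simp : v = v.re • (1 : ℂ) + v.im • (I : ℂ))]
    rw [_root_.sub_apply, map_add, map_smul, map_smul]
    simp [hH]
  intro z hz
  have hzp : 0 < ‖z‖ := ha.trans hz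
  have hz0 : z ≠ 0 := norm_pos_iff.1 hzp
  set d : ℝ → ℝ := fun t => h (t * z) - (f (t * z)⁻¹).re with hd
  have hin : ∀ t ∈ Set.Ioi (a / ‖z‖), a < ‖(t:ℂ) * z‖ := by
    intro t ht
    have ht' : a / ‖z‖ < t := ht
    rw [norm_mul, Complex.norm_real]
    rw [div_lt_iff₀ hzp] at ht'
    exact ht'.trans_le (by gcongr; exact le_abs_self t)
  have hdd : ∀ t ∈ Set.Ioi (a / ‖z‖), HasDerivAt d 0 t := by
    intro t ht
    have h1 : HasDerivAt (fun t : ℝ => (t:ℂ) * z) z t := by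
      simpa using (Complex.ofRealCLM.hasDerivAt (x := t)).mul_const z
    have := (hD _ (hin t ht)).comp_hasDerivAt t h1
    simpa using! this
  have hone : (1:ℝ) ∈ Set.Ioi (a / ‖z‖) := by
    simp only [Set.mem_Ioi]; rw [div_lt_one hzp]; exact hz
  have hconst : ∀ t ∈ Set.Ioi (a / ‖z‖), d t = d 1 := by
    intro t ht
    exact isOpen_Ioi.is_const_of_deriv_eq_zero isPreconnected_Ioi
      (fun t ht => (hdd t ht).differentiableAt.differentiableWithinAt)
      (fun t ht => (hdd t ht).deriv) ht hone
  have htz : Tendsto (fun t : ℝ => (t:ℂ) * z) atTop (cocompact ℂ) := by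
    rw [← Metric.cobounded_eq_cocompact, ← comap_norm_atTop, tendsto_comap_iff]
    have : (norm ∘ fun t : ℝ => (t:ℂ) * z) = fun t => |t| * ‖z‖ := by
      ext t; simp
    rw [this]
    exact tendsto_abs_atTop_atTop.atTop_mul_const hzp
  have hf0c : Tendsto f (𝓝 0) (𝓝 0) := by
    have := (hf 0 (mem_of_mem_nhds hnb)).continuousAt.tendsto
    rwa [hf0] at this
  have hl : Tendsto d atTop (𝓝 (0 - (0:ℂ).re)) := by
    refine (hlim.comp htz).sub ?_
    exact (Complex.continuous_re.tendsto 0).comp (hf0c.comp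
      ((Metric.cobounded_eq_cocompact (α := ℂ) ▸ tendsto_inv₀_cobounded (α := ℂ)).comp htz))
  have hl2 : Tendsto d atTop (𝓝 (d 1)) := by
    refine tendsto_const_nhds.congr' ?_
    filter_upwards [Ioi_mem_atTop (a / ‖z‖)] with t ht using (hconst t ht).symm
  have := tendsto_nhds_unique hl2 hl
  simp [hd] at this
  linarith

lemma ext_mono {h : ℂ → ℝ} {a r₁ r₂ : ℝ} (ha : 0 < a) (hh : HarmonicOnNhd h {z | a < ‖z‖})
    (hlim : Tendsto h (cocompact ℂ) (𝓝 0)) (h1 : a < r₁) (h12 : r₁ ≤ r₂) :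
    r₂ ^ 2 * circleAverage (fun z => h z ^ 2) 0 r₂ ≤
      r₁ ^ 2 * circleAverage (fun z => h z ^ 2) 0 r₁ := by
  obtain ⟨f, hf, hf0, hfh⟩ := ext_rep ha hh hlim
  have hnb : ball (0:ℂ) a⁻¹ ∈ 𝓝 (0:ℂ) := ball_mem_nhds _ (by positivity)
  have hp : DifferentiableOn ℂ (dslope f 0) (ball 0 a⁻¹) :=
    (Complex.differentiableOn_dslope hnb).2 hf
  have key : ∀ r, a < r → r ^ 2 * circleAverage (fun z => h z ^ 2) 0 r =
      circleAverage (fun z => ‖dslope f 0 z‖ ^ 2) 0 r⁻¹ / 2 := by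
    intro r hr
    have hr0 : 0 < r := ha.trans hr
    have e1 : circleAverage (fun z => h z ^ 2) 0 r =
        circleAverage (fun w => (f w).re ^ 2) 0 r⁻¹ := by
      rw [circleAverage_eq_circleAverage_zero_one,
        circleAverage_eq_circleAverage_zero_one (R := r⁻¹), ← circleAverage_zero_one_congr_inv]
      apply circleAverage_congr_sphere
      intro w hw
      have hw1 : ‖w‖ = 1 := by simpa using hw
      simp only
      rw [hfh]
      · simp [mul_comm]
      · simp [hw1, abs_of_pos hr0, hr]
    have hra : r⁻¹ < a⁻¹ := by gcongr
    rw [e1, avg_re_sq hf (by positivity) hra, hf0]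
    have e2 : circleAverage (fun z => ‖f z‖ ^ 2) 0 r⁻¹ =
        circleAverage (fun z => (r⁻¹ ^ 2) • ‖dslope f 0 z‖ ^ 2) 0 r⁻¹ := by
      apply circleAverage_congr_sphere
      intro w hw
      have hw1 : ‖w‖ = r⁻¹ := by simpa [abs_of_pos hr0] using hw
      have hw0 : w ≠ 0 := by
        rw [← norm_pos_iff, hw1]; positivity
      have : ‖f w‖ = ‖w‖ * ‖dslope f 0 w‖ := by
        rw [dslope_of_ne _ hw0, slope_def_field, hf0, ← norm_mul]
        congr 1
        field_simp; ring
      simp only [this, hw1, smul_eq_mul]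
      ring
    rw [e2, circleAverage_fun_smul]
    simp only [smul_eq_mul]
    simp
    field_simp
  rw [key _ h1, key _ (h1.trans_le h12)]
  have hr1 : 0 < r₁ := ha.trans h1
  have hr2 : 0 < r₂ := hr1.trans_le h12
  have := mono_avg hp (r₁ := r₂⁻¹) (r₂ := r₁⁻¹) (by positivity) (by gcongr) (by gcongr)
  linarith

end CA

section Polar
open Real Topology

lemma polar_lint {v : ℂ → ℝ} {S : Set ℝ} (hS : MeasurableSet S)
    (hv : ContinuousOn v {z | ‖z‖ ∈ S}) :
    ∫⁻ z in {z : ℂ | ‖z‖ ∈ S}, ENNReal.ofReal (v z ^ 2) =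
      ∫⁻ r in S ∩ Set.Ioi 0,
        ENNReal.ofReal (2 * π * (r * circleAverage (fun z => v z ^ 2) 0 r)) := by
  have hA : MeasurableSet {z : ℂ | ‖z‖ ∈ S} := measurable_norm hS
  rw [← lintegral_indicator hA, ← Complex.lintegral_comp_polarCoord_symm]
  set T := (S ∩ Set.Ioi (0:ℝ)) ×ˢ Set.Ioo (-π) π with hT
  have hSm : MeasurableSet (S ∩ Set.Ioi (0:ℝ)) := hS.inter measurableSet_Ioi
  have hTm : MeasurableSet T := hSm.prod measurableSet_Ioo
  set G : ℝ × ℝ → ENNReal := fun p =>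
    ENNReal.ofReal (p.1 * v (Complex.polarCoord.symm p) ^ 2) with hG
  have hmem : ∀ p ∈ T, ‖Complex.polarCoord.symm p‖ ∈ S := by
    rintro p ⟨⟨h1, h2⟩, h3⟩
    rw [Complex.norm_polarCoord_symm, abs_of_pos h2]
    exact h1
  have hpc : Continuous (fun p : ℝ × ℝ => Complex.polarCoord.symm p) := by
    simp only [Complex.polarCoord_symm_apply]
    fun_prop
  have hvc : ContinuousOn (fun p : ℝ × ℝ => p.1 * v (Complex.polarCoord.symm p) ^ 2) T := by
    exact continuousOn_fst.mul ((hv.comp hpc.continuousOn hmem).pow 2)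
  have step1 : (∫⁻ p in polarCoord.target, ENNReal.ofReal p.1 •
      ({z : ℂ | ‖z‖ ∈ S}.indicator (fun z => ENNReal.ofReal (v z ^ 2)))
        (Complex.polarCoord.symm p)) = ∫⁻ p in T, G p := by
    have htm : MeasurableSet polarCoord.target := polarCoord.open_target.measurableSet
    rw [← lintegral_indicator htm, ← lintegral_indicator hTm]
    congr 1
    ext p
    by_cases hp : p ∈ polarCoord.target
    · have hp' := hp
      rw [polarCoord_target] at hp'
      have h1 : 0 < p.1 := hp'.1
      rw [Set.indicator_of_mem hp]
      by_cases hs : p.1 ∈ S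
      · rw [Set.indicator_of_mem (show p ∈ T from ⟨⟨hs, h1⟩, hp'.2⟩), Set.indicator_of_mem]
        · rw [smul_eq_mul, ← ENNReal.ofReal_mul h1.le]
        · exact hmem p ⟨⟨hs, h1⟩, hp'.2⟩
      · rw [Set.indicator_of_notMem (show p ∉ T from fun h => hs h.1.1), Set.indicator_of_notMem,
          smul_zero]
        simp only [Set.mem_ofPred_eq, Complex.norm_polarCoord_symm, abs_of_pos h1]
        exact hs
    · rw [Set.indicator_of_notMem hp, Set.indicator_of_notMem]
      intro h
      apply hp
      rw [polarCoord_target]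
      exact ⟨h.1.2, h.2⟩
  rw [step1, hT, Measure.volume_eq_prod, ← Measure.prod_restrict, lintegral_prod]
  · refine setLIntegral_congr_fun hSm ?_
    intro r hr
    have hr0 : 0 < r := hr.2
    simp only [hG]
    have hcirc : ∀ θ : ℝ, Complex.polarCoord.symm (r, θ) = circleMap 0 r θ := by
      intro θ
      rw [Complex.polarCoord_symm_apply, circleMap, Complex.exp_mul_I]
      simp
    simp only [hcirc]
    have hcc : Continuous (fun θ : ℝ => v (circleMap 0 r θ) ^ 2) := by
      refine (hv.comp_continuous (by fun_prop) ?_).pow 2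
      intro θ
      simp only [Set.mem_ofPred_eq, norm_circleMap_zero, abs_of_pos hr0]
      exact hr.1
    have hii : IntegrableOn (fun θ : ℝ => r * v (circleMap 0 r θ) ^ 2) (Set.Ioo (-π) π) :=
      ((continuous_const.mul hcc).integrableOn_Icc (a := -π) (b := π)).mono_set
        Set.Ioo_subset_Icc_self
    rw [← ofReal_integral_eq_lintegral_ofReal hii (ae_of_all _ fun θ => by positivity)]
    congr 1
    rw [← integral_Ioc_eq_integral_Ioo, ← intervalIntegral.integral_of_le (by linarith [pi_pos]),
      intervalIntegral.integral_const_mul, circleAverage_def, smul_eq_mul]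
    have hper : Function.Periodic (fun θ : ℝ => v (circleMap 0 r θ) ^ 2) (2 * π) := by
      intro x
      simp only [periodic_circleMap 0 r x]
    have := hper.intervalIntegral_add_eq (-π) 0
    rw [show -π + 2 * π = π by ring, zero_add] at this
    rw [this]
    field_simp
  · rw [Measure.prod_restrict, ← Measure.volume_eq_prod]
    exact (hvc.aemeasurable hTm).ennreal_ofReal

lemma lint_lin {a b C : ℝ} (ha : 0 ≤ a) (hab : a ≤ b) (hC : 0 ≤ C) :
    ∫⁻ r in Set.Ioo a b, ENNReal.ofReal (C * r) = ENNReal.ofReal (C * ((b ^ 2 - a ^ 2) / 2)) := by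
  rw [← ofReal_integral_eq_lintegral_ofReal]
  · rw [← integral_Ioc_eq_integral_Ioo, ← intervalIntegral.integral_of_le hab,
      intervalIntegral.integral_const_mul, integral_id]
  · exact ((continuous_const.mul continuous_id).integrableOn_Icc (a := a) (b := b)).mono_set
        Set.Ioo_subset_Icc_self
  · refine (ae_restrict_iff' measurableSet_Ioo).2 (ae_of_all _ fun r hr => ?_)
    exact mul_nonneg hC (ha.trans hr.1.le)

lemma lint_inv {a b C : ℝ} (ha : 0 < a) (hab : a ≤ b) (hC : 0 ≤ C) :
    ∫⁻ r in Set.Ioo a b, ENNReal.ofReal (C * r⁻¹) = ENNReal.ofReal (C * Real.log (b / a)) := by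
  rw [← ofReal_integral_eq_lintegral_ofReal]
  · rw [← integral_Ioc_eq_integral_Ioo, ← intervalIntegral.integral_of_le hab,
      intervalIntegral.integral_const_mul, integral_inv_of_pos ha (ha.trans_le hab)]
  · have : ContinuousOn (fun r : ℝ => C * r⁻¹) (Set.Icc a b) :=
      continuousOn_const.mul (continuousOn_id.inv₀ fun x hx => (ha.trans_le hx.1).ne')
    exact (this.integrableOn_Icc).mono_set Set.Ioo_subset_Icc_self
  · refine (ae_restrict_iff' measurableSet_Ioo).2 (ae_of_all _ fun r hr => ?_)
    exact mul_nonneg hC (inv_nonneg.2 (ha.trans hr.1).le)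

lemma avg_sq_nonneg (v : ℂ → ℝ) (r : ℝ) : 0 ≤ circleAverage (fun z => v z ^ 2) 0 r := by
  apply circleAverage_nonneg_of_nonneg
  intro x _
  positivity

lemma int_ineq {g : ℂ → ℝ} {Rp Ri : ℝ} (hp : 0 < Rp) (hpi : Rp < Ri)
    (hg : InnerProductSpace.HarmonicOnNhd g (ball 0 Ri)) :
    (∫⁻ z in {z : ℂ | ‖z‖ ∈ Set.Iio Rp}, ENNReal.ofReal (g z ^ 2)) * ENNReal.ofReal (Ri ^ 2 - Rp ^ 2)
      ≤ (∫⁻ z in {z : ℂ | ‖z‖ ∈ Set.Ico Rp Ri}, ENNReal.ofReal (g z ^ 2)) *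
        ENNReal.ofReal (Rp ^ 2) := by
  have hc : ContinuousOn g (ball 0 Ri) := hg.continuousOn
  have s1 : {z : ℂ | ‖z‖ ∈ Set.Iio Rp} ⊆ ball 0 Ri := by
    intro z hz
    have : ‖z‖ < Rp := hz
    simp; linarith
  have s2 : {z : ℂ | ‖z‖ ∈ Set.Ico Rp Ri} ⊆ ball 0 Ri := by
    intro z hz
    simpa using hz.2
  rw [polar_lint measurableSet_Iio (hc.mono s1), polar_lint measurableSet_Ico (hc.mono s2)]
  set m := circleAverage (fun z => g z ^ 2) 0 Rp with hm
  have hm0 : 0 ≤ m := avg_sq_nonneg g Rp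
  have e1 : Set.Iio Rp ∩ Set.Ioi 0 = Set.Ioo 0 Rp := by
    rw [Set.inter_comm, Set.Ioi_inter_Iio]
  have e2 : Set.Ico Rp Ri ∩ Set.Ioi 0 = Set.Ico Rp Ri := by
    apply Set.inter_eq_left.2
    intro r hr; exact hp.trans_le hr.1
  rw [e1, e2, setLIntegral_congr Ioo_ae_eq_Ico.symm]
  have i1 : ∫⁻ r in Set.Ioo 0 Rp,
      ENNReal.ofReal (2 * π * (r * circleAverage (fun z => g z ^ 2) 0 r)) ≤
      ENNReal.ofReal ((2 * π * m) * ((Rp ^ 2 - 0 ^ 2) / 2)) := by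
    rw [← lint_lin le_rfl hp.le (by positivity)]
    refine setLIntegral_mono' measurableSet_Ioo fun r hr => ENNReal.ofReal_le_ofReal ?_
    have := int_mono hg hr.1.le hr.2.le hpi
    have h1 := mul_le_mul_of_nonneg_left this (show 0 ≤ 2 * π * r by have := hr.1; positivity)
    linarith
  have i2 : ENNReal.ofReal ((2 * π * m) * ((Ri ^ 2 - Rp ^ 2) / 2)) ≤ ∫⁻ r in Set.Ioo Rp Ri,
      ENNReal.ofReal (2 * π * (r * circleAverage (fun z => g z ^ 2) 0 r)) := by
    rw [← lint_lin hp.le hpi.le (by positivity)]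
    refine setLIntegral_mono' measurableSet_Ioo fun r hr => ENNReal.ofReal_le_ofReal ?_
    have := int_mono hg hp.le hr.1.le hr.2
    have h1 := mul_le_mul_of_nonneg_left this
      (show 0 ≤ 2 * π * r by have := hp.trans hr.1; positivity)
    linarith
  refine (mul_le_mul_left i1 _).trans (le_trans (le_of_eq ?_) (mul_le_mul_left i2 _))
  have hsq : Rp ^ 2 ≤ Ri ^ 2 := by gcongr
  rw [← ENNReal.ofReal_mul (mul_nonneg (by positivity) (by nlinarith [sq_nonneg Rp])),
    ← ENNReal.ofReal_mul (mul_nonneg (by positivity) (by linarith))]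
  congr 1
  ring

lemma ext_ineq {h : ℂ → ℝ} {Rm Rp Re : ℝ} (hm : 0 < Rm) (hmp : Rm < Rp) (hpe : Rp < Re)
    (hh : InnerProductSpace.HarmonicOnNhd h {z | Rm < ‖z‖})
    (hlim : Tendsto h (cocompact ℂ) (𝓝 0)) :
    (∫⁻ z in {z : ℂ | ‖z‖ ∈ Set.Ico Rp Re}, ENNReal.ofReal (h z ^ 2)) *
        ENNReal.ofReal (Real.log (Rp / Rm))
      ≤ (∫⁻ z in {z : ℂ | ‖z‖ ∈ Set.Ioo Rm Rp}, ENNReal.ofReal (h z ^ 2)) *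
        ENNReal.ofReal (Real.log (Re / Rp)) := by
  have hp : 0 < Rp := hm.trans hmp
  have hc : ContinuousOn h {z | Rm < ‖z‖} := hh.continuousOn
  have s1 : {z : ℂ | ‖z‖ ∈ Set.Ico Rp Re} ⊆ {z | Rm < ‖z‖} :=
    fun z hz => hmp.trans_le hz.1
  have s2 : {z : ℂ | ‖z‖ ∈ Set.Ioo Rm Rp} ⊆ {z | Rm < ‖z‖} := fun z hz => hz.1
  rw [polar_lint measurableSet_Ico (hc.mono s1), polar_lint measurableSet_Ioo (hc.mono s2)]
  set N := Rp ^ 2 * circleAverage (fun z => h z ^ 2) 0 Rp with hN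
  have hN0 : 0 ≤ N := mul_nonneg (by positivity) (avg_sq_nonneg h Rp)
  have e1 : Set.Ico Rp Re ∩ Set.Ioi 0 = Set.Ico Rp Re := by
    apply Set.inter_eq_left.2
    intro r hr; exact hp.trans_le hr.1
  have e2 : Set.Ioo Rm Rp ∩ Set.Ioi 0 = Set.Ioo Rm Rp := by
    apply Set.inter_eq_left.2
    intro r hr; exact hm.trans hr.1
  rw [e1, e2, setLIntegral_congr Ioo_ae_eq_Ico.symm]
  have hform : ∀ r : ℝ, 0 < r → 2 * π * (r * circleAverage (fun z => h z ^ 2) 0 r) =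
      2 * π * r⁻¹ * (r ^ 2 * circleAverage (fun z => h z ^ 2) 0 r) := by
    intro r hr
    field_simp
  have i1 : ∫⁻ r in Set.Ioo Rp Re,
      ENNReal.ofReal (2 * π * (r * circleAverage (fun z => h z ^ 2) 0 r)) ≤
      ENNReal.ofReal ((2 * π * N) * Real.log (Re / Rp)) := by
    rw [← lint_inv hp hpe.le (by positivity)]
    refine setLIntegral_mono' measurableSet_Ioo fun r hr => ENNReal.ofReal_le_ofReal ?_
    have hr0 : 0 < r := hp.trans hr.1
    have := ext_mono hm hh hlim hmp hr.1.le
    rw [hform r hr0]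
    have h1 := mul_le_mul_of_nonneg_left this (show 0 ≤ 2 * π * r⁻¹ by positivity)
    linarith
  have i2 : ENNReal.ofReal ((2 * π * N) * Real.log (Rp / Rm)) ≤ ∫⁻ r in Set.Ioo Rm Rp,
      ENNReal.ofReal (2 * π * (r * circleAverage (fun z => h z ^ 2) 0 r)) := by
    rw [← lint_inv hm hmp.le (by positivity)]
    refine setLIntegral_mono' measurableSet_Ioo fun r hr => ENNReal.ofReal_le_ofReal ?_
    have hr0 : 0 < r := hm.trans hr.1
    have := ext_mono hm hh hlim hr.1 hr.2.le
    rw [hform r hr0]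
    have h1 := mul_le_mul_of_nonneg_left this (show 0 ≤ 2 * π * r⁻¹ by positivity)
    linarith
  refine (mul_le_mul_left i1 _).trans (le_trans (le_of_eq ?_) (mul_le_mul_left i2 _))
  have l1 : 0 ≤ Real.log (Re / Rp) := Real.log_nonneg (by rw [le_div_iff₀ hp]; linarith)
  have l2 : 0 ≤ Real.log (Rp / Rm) := Real.log_nonneg (by rw [le_div_iff₀ hm]; linarith)
  rw [← ENNReal.ofReal_mul (by positivity), ← ENNReal.ofReal_mul (by positivity)]
  congr 1
  ring

end Polar

section Transfer
open Real Topology InnerProductSpace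

/-- the isometric identification of the complex plane with `ℝ²`, centred at `c` -/
def Tmap (c : Pt) (z : ℂ) : Pt := c + Complex.orthonormalBasisOneI.repr z

lemma Tmap_dist (c : Pt) (z : ℂ) : dist (Tmap c z) c = ‖z‖ := by
  simp [Tmap, dist_eq_norm]

lemma Tmap_cont (c : Pt) : Continuous (Tmap c) :=
  continuous_const.add Complex.orthonormalBasisOneI.repr.continuous

/-- the identification as a homeomorphism -/
def Thomeo (c : Pt) : ℂ ≃ₜ Pt :=
  Complex.orthonormalBasisOneI.repr.toHomeomorph.trans (Homeomorph.addLeft c)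

lemma Thomeo_eq (c : Pt) : ⇑(Thomeo c) = Tmap c := rfl

lemma Tmap_mp (c : Pt) : MeasurePreserving (Tmap c) volume volume :=
  (measurePreserving_add_left volume c).comp
    (OrthonormalBasis.measurePreserving_repr Complex.orthonormalBasisOneI)

lemma Tmap_emb (c : Pt) : MeasurableEmbedding (Tmap c) := by
  rw [← Thomeo_eq]; exact (Thomeo c).measurableEmbedding

lemma Tmap_cocompact (c : Pt) : Tendsto (Tmap c) (cocompact ℂ) (cocompact Pt) := by
  rw [← Thomeo_eq]; exact (Thomeo c).isClosedEmbedding.tendsto_cocompact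

lemma Tmap_lint (c : Pt) (S : Set ℝ) (f : Pt → ENNReal) :
    ∫⁻ z in {z : ℂ | ‖z‖ ∈ S}, f (Tmap c z) = ∫⁻ x in {x : Pt | dist x c ∈ S}, f x := by
  have := (Tmap_mp c).setLIntegral_comp_preimage_emb (Tmap_emb c) f {x : Pt | dist x c ∈ S}
  rw [← this]
  congr 2
  ext z
  simp [Tmap_dist]

lemma Tmap_lap (c : Pt) (g : Pt → ℝ) (z : ℂ) :
    Laplacian.laplacian (g ∘ Tmap c) z = lap g (Tmap c z) := by
  rw [laplacian_eq_iteratedFDeriv_orthonormalBasis _ Complex.orthonormalBasisOneI]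
  unfold lap
  have h1 : iteratedFDeriv ℝ 2 (g ∘ Tmap c) z = (iteratedFDeriv ℝ 2 g (Tmap c z)).compContinuousLinearMap
      fun _ => (Complex.orthonormalBasisOneI.repr.toContinuousLinearEquiv : ℂ →L[ℝ] Pt) := by
    have := Complex.orthonormalBasisOneI.repr.toContinuousLinearEquiv.iteratedFDerivWithin_comp_right
      (fun x => g (c + x)) uniqueDiffOn_univ (x := z) (Set.mem_univ _) 2
    simp only [Set.preimage_univ, iteratedFDerivWithin_univ] at this
    rw [iteratedFDeriv_comp_add_left] at this
    exact this
  refine Finset.sum_congr rfl fun i _ => ?_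
  rw [h1, ContinuousMultilinearMap.compContinuousLinearMap_apply]
  congr 1
  ext j : 1
  have : Complex.orthonormalBasisOneI.repr (Complex.orthonormalBasisOneI i)
    = EuclideanSpace.single i (1 : ℝ) := OrthonormalBasis.repr_self _ _
  fin_cases j <;> simpa using this

lemma Tmap_harm {c : Pt} {g : Pt → ℝ} {U : Set Pt} (hU : IsOpen U) (hg : IsHarmonicOn g U)
    {z : ℂ} (hz : Tmap c z ∈ U) : HarmonicAt (g ∘ Tmap c) z := by
  constructor
  · have h1 : ContDiffAt ℝ 2 g (Tmap c z) := hg.1.contDiffAt (hU.mem_nhds hz)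
    refine h1.comp z ?_
    exact (contDiff_const.add
      (Complex.orthonormalBasisOneI.repr.toContinuousLinearEquiv.contDiff)).contDiffAt
  · filter_upwards [(Tmap_cont c).continuousAt.preimage_mem_nhds (hU.mem_nhds hz)] with w hw
    rw [Tmap_lap]
    exact hg.2 _ hw

lemma harm_add {U : Set Pt} (hU : IsOpen U) {f g : Pt → ℝ} (hf : IsHarmonicOn f U)
    (hg : IsHarmonicOn g U) : IsHarmonicOn (f + g) U := by
  refine ⟨hf.1.add hg.1, fun x hx => ?_⟩
  have h1 := hf.2 x hx
  have h2 := hg.2 x hx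
  unfold lap at *
  rw [iteratedFDeriv_add_apply (hf.1.contDiffAt (hU.mem_nhds hx))
    (hg.1.contDiffAt (hU.mem_nhds hx))]
  simp only [_root_.add_apply, Finset.sum_add_distrib, h1, h2, add_zero]

lemma harm_smul {U : Set Pt} (hU : IsOpen U) {f : Pt → ℝ} (a : ℝ) (hf : IsHarmonicOn f U) :
    IsHarmonicOn (a • f) U := by
  refine ⟨hf.1.const_smul a, fun x hx => ?_⟩
  have h1 := hf.2 x hx
  unfold lap at *
  rw [iteratedFDeriv_const_smul_apply (hf.1.contDiffAt (hU.mem_nhds hx))]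
  simp only [_root_.smul_apply, ← Finset.smul_sum, h1, smul_zero]

lemma harm_zero (U : Set Pt) : IsHarmonicOn 0 U := by
  refine ⟨contDiffOn_const, fun x _ => ?_⟩
  have : iteratedFDeriv ℝ 2 (0 : Pt → ℝ) = 0 := iteratedFDeriv_fun_zero
  simp [lap, this]

end Transfer

section Split
open Real Topology

lemma cs_split {α : Type*} [MeasurableSpace α] {μ : Measure α} {S : Set α} (hS : MeasurableSet S)
    (u v : Lp ℝ 2 μ) {k : ℝ} (hk : 0 ≤ k)
    (hu : ∫⁻ x in Sᶜ, ENNReal.ofReal (u x ^ 2) ∂μ ≤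
      ENNReal.ofReal k * ∫⁻ x, ENNReal.ofReal (u x ^ 2) ∂μ)
    (hv : ∫⁻ x in S, ENNReal.ofReal (v x ^ 2) ∂μ ≤
      ENNReal.ofReal k * ∫⁻ x, ENNReal.ofReal (v x ^ 2) ∂μ) :
    inner ℝ u v ≤ 2 * √k * ‖u‖ * ‖v‖ := by
  have key : ∀ w : Lp ℝ 2 μ, (∫⁻ x, ENNReal.ofReal (w x ^ 2) ∂μ) ^ (1 / 2 : ℝ) = ‖w‖ₑ := by
    intro w
    rw [Lp.enorm_def, eLpNorm_eq_lintegral_rpow_enorm_toReal (by simp) (by simp)]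
    simp only [ENNReal.toReal_ofNat]
    congr 2
    ext x
    rw [← ofReal_norm, ENNReal.ofReal_rpow_of_nonneg (norm_nonneg _) (by norm_num)]
    simp
  have cs : ∀ A : Set α, ∫⁻ x in A, ‖u x‖ₑ * ‖v x‖ₑ ∂μ ≤
      (∫⁻ x in A, ENNReal.ofReal (u x ^ 2) ∂μ) ^ (1 / 2 : ℝ) *
      (∫⁻ x in A, ENNReal.ofReal (v x ^ 2) ∂μ) ^ (1 / 2 : ℝ) := by
    intro A
    have hh : ∀ t : ℝ, ENNReal.ofReal (t ^ 2) = ‖t‖ₑ ^ (2 : ℝ) := by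
      intro t
      rw [← ofReal_norm, ENNReal.ofReal_rpow_of_nonneg (norm_nonneg _) (by norm_num)]
      simp
    simp only [hh]
    exact ENNReal.lintegral_mul_le_Lp_mul_Lq (μ.restrict A) Real.HolderConjugate.two_two
      (Lp.aestronglyMeasurable u).enorm.restrict (Lp.aestronglyMeasurable v).enorm.restrict
  have hsq : ∀ a : ENNReal, (ENNReal.ofReal k * a) ^ (1 / 2 : ℝ) =
      ENNReal.ofReal (√k) * a ^ (1 / 2 : ℝ) := by
    intro a
    rw [ENNReal.mul_rpow_of_nonneg _ _ (by norm_num),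
      ENNReal.ofReal_rpow_of_nonneg hk (by norm_num), Real.sqrt_eq_rpow]
  have hmono : ∀ {a b : ENNReal}, a ≤ b → a ^ (1 / 2 : ℝ) ≤ b ^ (1 / 2 : ℝ) :=
    fun h => ENNReal.rpow_le_rpow h (by norm_num)
  have h1 : ∫⁻ x in S, ‖u x‖ₑ * ‖v x‖ₑ ∂μ ≤ ENNReal.ofReal (√k) * ‖u‖ₑ * ‖v‖ₑ := by
    refine (cs S).trans ((mul_le_mul' (hmono (setLIntegral_le_lintegral _ _)) (hmono hv)).trans
      (le_of_eq ?_))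
    rw [hsq, key, key]; ring
  have h2 : ∫⁻ x in Sᶜ, ‖u x‖ₑ * ‖v x‖ₑ ∂μ ≤ ENNReal.ofReal (√k) * ‖u‖ₑ * ‖v‖ₑ := by
    refine (cs Sᶜ).trans ((mul_le_mul' (hmono hu) (hmono (setLIntegral_le_lintegral _ _))).trans
      (le_of_eq ?_))
    rw [hsq, key, key]
  have h3 : ‖inner ℝ u v‖ₑ ≤ ENNReal.ofReal (2 * √k * ‖u‖ * ‖v‖) := by
    rw [L2.inner_def]
    refine (enorm_integral_le_lintegral_enorm _).trans ?_
    have : ∀ x, ‖inner ℝ (u x) (v x)‖ₑ = ‖u x‖ₑ * ‖v x‖ₑ := by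
      intro x
      rw [← enorm_mul]; simp [mul_comm]
    simp only [this]
    rw [← lintegral_add_compl _ hS]
    refine (add_le_add h1 h2).trans (le_of_eq ?_)
    rw [ENNReal.ofReal_mul (by positivity), ENNReal.ofReal_mul (by positivity),
      ENNReal.ofReal_mul (by positivity), ofReal_norm, ofReal_norm]
    simp only [ENNReal.ofReal_ofNat]
    ring
  rw [← ofReal_norm, ENNReal.ofReal_le_ofReal_iff (by positivity)] at h3
  exact (le_abs_self _).trans h3

end Split

section Final
open Real Topology

lemma enn_aux {X Y X' Y' : ENNReal} {a b k : ℝ} (ha : 0 ≤ a) (hb : 0 ≤ b) (hab : 0 < a + b)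
    (hX : X' ≤ X) (hY : Y ≤ Y') (h : X * ENNReal.ofReal a ≤ Y * ENNReal.ofReal b)
    (hk : b / (a + b) ≤ k) : X' ≤ ENNReal.ofReal k * (X' + Y') := by
  have h1 : X' * ENNReal.ofReal a ≤ Y' * ENNReal.ofReal b :=
    (mul_le_mul' hX le_rfl).trans (h.trans (mul_le_mul' hY le_rfl))
  have h2 : X' * ENNReal.ofReal (a + b) ≤ (X' + Y') * ENNReal.ofReal b := by
    rw [ENNReal.ofReal_add ha hb, mul_add, add_mul, add_comm]
    gcongr
  have h3 : X' ≤ ENNReal.ofReal (b / (a + b)) * (X' + Y') := by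
    rw [ENNReal.ofReal_div_of_pos hab, mul_comm, ← mul_div_assoc]
    rw [ENNReal.le_div_iff_mul_le (Or.inl (by simpa using hab)) (Or.inl ENNReal.ofReal_ne_top)]
    exact h2
  exact h3.trans (mul_le_mul' (ENNReal.ofReal_le_ofReal hk) le_rfl)

variable {𝒢 𝒪 : Set Pt} {c : Pt} {Re Ri Rp Rm δ δ₀ : ℝ}

lemma geom_delta (geom : Geometry 𝒢 𝒪 c Re Ri Rp Rm δ δ₀) : 2 < δ₀ := by
  have h1 : 0 < Ri := geom.Rm_pos.trans (geom.Rm_lt_Rp.trans geom.Rp_lt_Ri)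
  have := Real.log_pos ((one_lt_div h1).2 geom.Ri_lt_Re)
  linarith [geom.δ₀_eq]

lemma g_bound (geom : Geometry 𝒢 𝒪 c Re Ri Rp Rm δ δ₀) {g : Pt → ℝ} (hg : IsHarmonicOn g 𝒢) :
    ∫⁻ x in ball c Rp, ENNReal.ofReal (g x ^ 2) ∂(volume.restrict (𝒢 \ closure 𝒪)) ≤
      ENNReal.ofReal (δ₀ / δ) *
        ∫⁻ x, ENNReal.ofReal (g x ^ 2) ∂(volume.restrict (𝒢 \ closure 𝒪)) := by
  have hm := geom.Rm_pos
  have hp : 0 < Rp := hm.trans geom.Rm_lt_Rp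
  have hi : 0 < Ri := hp.trans geom.Rp_lt_Ri
  have he : 0 < Re := hi.trans geom.Ri_lt_Re
  have hd := geom_delta geom
  have hd2 := geom.δ₀_lt_δ
  have key := int_ineq (g := g ∘ Tmap c) hp geom.Rp_lt_Ri (by
    intro z hz
    refine Tmap_harm geom.openG hg (geom.clDi_sub ?_)
    rw [mem_closedBall, Tmap_dist]
    simpa using (mem_ball_zero_iff.1 hz).le)
  simp only [Function.comp_apply] at key
  rw [Tmap_lint c (Set.Iio Rp) (fun x => ENNReal.ofReal (g x ^ 2)),
    Tmap_lint c (Set.Ico Rp Ri) (fun x => ENNReal.ofReal (g x ^ 2))] at key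
  rw [← lintegral_add_compl (μ := volume.restrict (𝒢 \ closure 𝒪)) _
      (measurableSet_ball (x := c) (ε := Rp)),
    Measure.restrict_restrict measurableSet_ball,
    Measure.restrict_restrict measurableSet_ball.compl]
  have hsq : Rp ^ 2 < Ri ^ 2 := by
    have := geom.Rp_lt_Ri
    gcongr
  refine enn_aux (by linarith) (by positivity) (by linarith [sq_nonneg Rp, pow_pos hi 2]) ?_ ?_ key ?_
  · refine lintegral_mono_set fun x hx => ?_
    exact hx.1
  · refine lintegral_mono_set fun x hx => ⟨?_, ?_, ?_⟩
    · simpa using hx.1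
    · exact geom.clDi_sub hx.2.le
    · intro h
      have h1 := mem_ball.1 (geom.clO_sub h)
      have h2 := geom.Rm_lt_Rp
      have h3 := hx.1
      linarith
  · rw [sub_add_cancel]
    have hlog : Real.log (Re / Ri) = δ₀ - 2 := by linarith [geom.δ₀_eq]
    have e1 : Re / Ri = Real.exp (δ₀ - 2) := by
      rw [← hlog, Real.exp_log (by positivity)]
    have e2 : Rp ^ 2 / Ri ^ 2 = Real.exp (-(2 * (δ - δ₀ + 2))) := by
      rw [← div_pow]
      have : Rp / Ri = Real.exp (-(δ - δ₀ + 2)) := by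
        rw [geom.Rp_eq, mul_comm, mul_div_assoc, e1, ← Real.exp_add]
        congr 1; ring
      rw [this, ← Real.exp_nat_mul]
      congr 1; push_cast; ring
    rw [e2, Real.exp_neg, ← inv_div]
    refine inv_anti₀ (div_pos (by linarith) (by linarith)) ?_
    have := Real.add_one_le_exp (2 * (δ - δ₀ + 2))
    refine le_trans ?_ this
    rw [div_le_iff₀ (by linarith)]
    nlinarith

lemma h_bound (geom : Geometry 𝒢 𝒪 c Re Ri Rp Rm δ δ₀) {h : Pt → ℝ}
    (hh : IsHarmonicOn h (closure 𝒪)ᶜ) (hlim : Tendsto h (cocompact Pt) (nhds 0)) :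
    ∫⁻ x in (ball c Rp)ᶜ, ENNReal.ofReal (h x ^ 2) ∂(volume.restrict (𝒢 \ closure 𝒪)) ≤
      ENNReal.ofReal (δ₀ / δ) *
        ∫⁻ x, ENNReal.ofReal (h x ^ 2) ∂(volume.restrict (𝒢 \ closure 𝒪)) := by
  have hm := geom.Rm_pos
  have hp : 0 < Rp := hm.trans geom.Rm_lt_Rp
  have hi : 0 < Ri := hp.trans geom.Rp_lt_Ri
  have he : 0 < Re := hi.trans geom.Ri_lt_Re
  have hd := geom_delta geom
  have hd2 := geom.δ₀_lt_δ
  have key := ext_ineq (h := h ∘ Tmap c) hm geom.Rm_lt_Rp (geom.Rp_lt_Ri.trans geom.Ri_lt_Re) (by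
    intro z hz
    refine Tmap_harm isClosed_closure.isOpen_compl hh (fun hz' => ?_)
    have h1 := mem_ball.1 (geom.clO_sub hz')
    rw [Tmap_dist] at h1
    exact lt_asymm h1 hz) (hlim.comp (Tmap_cocompact c))
  simp only [Function.comp_apply] at key
  rw [Tmap_lint c (Set.Ico Rp Re) (fun x => ENNReal.ofReal (h x ^ 2)),
    Tmap_lint c (Set.Ioo Rm Rp) (fun x => ENNReal.ofReal (h x ^ 2))] at key
  rw [← lintegral_add_compl (μ := volume.restrict (𝒢 \ closure 𝒪)) _
      (measurableSet_ball (x := c) (ε := Rp)),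
    add_comm (lintegral _ _) (lintegral _ _),
    Measure.restrict_restrict measurableSet_ball,
    Measure.restrict_restrict measurableSet_ball.compl]
  have l1 : Real.log (Re / Rp) = δ := by
    rw [geom.Rp_eq, Real.log_div he.ne' (by positivity), Real.log_mul he.ne' (by positivity),
      Real.log_exp]
    ring
  have l2 : Real.log (Rp / Rm) = δ ^ 2 - δ := by
    rw [geom.Rp_eq, geom.Rm_eq, Real.log_div (by positivity) (by positivity),
      Real.log_mul he.ne' (by positivity), Real.log_mul he.ne' (by positivity),
      Real.log_exp, Real.log_exp]
    ring
  rw [l1, l2] at key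
  refine enn_aux (by nlinarith) (by linarith) (by nlinarith) ?_ ?_ key ?_
  · refine lintegral_mono_set fun x hx => ⟨?_, ?_⟩
    · simpa using hx.1
    · exact geom.clG_sub (subset_closure hx.2.1)
  · refine lintegral_mono_set fun x hx => ⟨hx.2, ?_, ?_⟩
    · refine geom.clDi_sub (le_of_lt (hx.2.trans geom.Rp_lt_Ri))
    · intro h
      exact lt_asymm (mem_ball.1 (geom.clO_sub h)) hx.1
  · rw [sub_add_cancel]
    have hδ : 0 < δ := by linarith
    rw [div_le_div_iff₀ (by positivity) hδ]
    nlinarith [pow_pos hδ 2]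

end Final

theorem stmt10 (𝒢 𝒪 : Set Pt) (c : Pt) (Re Ri Rp Rm δ δ₀ : ℝ)
    (geom : Geometry 𝒢 𝒪 c Re Ri Rp Rm δ δ₀)
    (h : Pt → ℝ) (hh : IsHarmonicOn h (closure 𝒪)ᶜ)
    (hloc : LocallyIntegrableOn (fun x => h x ^ 2) (closure 𝒪)ᶜ)
    (hlim : Tendsto h (cocompact Pt) (nhds 0))
    (hmem : MemLp h 2 (volume.restrict (𝒢 \ closure 𝒪))) :
    ‖(Submodule.orthogonalProjectionOnto (HGclosure 𝒢 (𝒢 \ closure 𝒪)) (hmem.toLp h) :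
        Lp ℝ 2 (volume.restrict (𝒢 \ closure 𝒪)))‖
      ≤ 2 * Real.sqrt (δ₀ / δ) * ‖hmem.toLp h‖ := by

  set F := 𝒢 \ closure 𝒪 with hF
  set u : Lp ℝ 2 (volume.restrict F) := hmem.toLp h with hu
  have hd := geom_delta geom
  have hd2 := geom.δ₀_lt_δ
  have huh : (u : Pt → ℝ) =ᵐ[volume.restrict F] h := hmem.coeFn_toLp
  have ub : ∫⁻ x in (ball c Rp)ᶜ, ENNReal.ofReal (u x ^ 2) ∂(volume.restrict F) ≤
      ENNReal.ofReal (δ₀ / δ) * ∫⁻ x, ENNReal.ofReal (u x ^ 2) ∂(volume.restrict F) := by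
    have e : (fun x => ENNReal.ofReal (u x ^ 2)) =ᵐ[volume.restrict F]
        fun x => ENNReal.ofReal (h x ^ 2) := huh.mono fun x hx => by simp only [hx]
    rw [lintegral_congr_ae e, lintegral_congr_ae (ae_restrict_of_ae e)]
    exact h_bound geom hh hlim
  have hbase : ∀ f ∈ Submodule.span ℝ {f : Lp ℝ 2 (volume.restrict F) |
      ∃ g : Pt → ℝ, IsHarmonicOn g 𝒢 ∧ IntegrableOn (fun x => g x ^ 2) 𝒢 ∧
        (f : Pt → ℝ) =ᵐ[volume.restrict F] g},
      ∃ g : Pt → ℝ, IsHarmonicOn g 𝒢 ∧ (f : Pt → ℝ) =ᵐ[volume.restrict F] g := by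
    intro f hf
    induction hf using Submodule.span_induction with
    | mem f hf => obtain ⟨g, h1, _, h2⟩ := hf; exact ⟨g, h1, h2⟩
    | zero => exact ⟨0, harm_zero 𝒢, Lp.coeFn_zero _ _ _⟩
    | add f₁ f₂ _ _ ih1 ih2 =>
      obtain ⟨g₁, h1, h2⟩ := ih1
      obtain ⟨g₂, h3, h4⟩ := ih2
      exact ⟨g₁ + g₂, harm_add geom.openG h1 h3, (Lp.coeFn_add _ _).trans (h2.add h4)⟩
    | smul a f _ ih =>
      obtain ⟨g, h1, h2⟩ := ih
      exact ⟨a • g, harm_smul geom.openG a h1, (Lp.coeFn_smul _ _).trans (h2.const_smul a)⟩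
  have hall : ∀ f ∈ HGclosure 𝒢 F,
      inner ℝ u f ≤ 2 * Real.sqrt (δ₀ / δ) * ‖u‖ * ‖f‖ := by
    have hcl : IsClosed {f : Lp ℝ 2 (volume.restrict F) |
        inner ℝ u f ≤ 2 * Real.sqrt (δ₀ / δ) * ‖u‖ * ‖f‖} :=
      isClosed_le (by fun_prop) (by fun_prop)
    intro f hf
    refine closure_minimal ?_ hcl hf
    intro f hf
    obtain ⟨g, hg, hfg⟩ := hbase f hf
    refine cs_split measurableSet_ball u f (div_nonneg (by linarith) (by linarith)) ub ?_
    have e : (fun x => ENNReal.ofReal (f x ^ 2)) =ᵐ[volume.restrict F]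
        fun x => ENNReal.ofReal (g x ^ 2) := hfg.mono fun x hx => by simp only [hx]
    rw [lintegral_congr_ae e, lintegral_congr_ae (ae_restrict_of_ae e)]
    exact g_bound geom hg
  set p := Submodule.orthogonalProjectionOnto (HGclosure 𝒢 F) u with hp
  have h1 := hall p p.2
  have h2 : inner ℝ u (p : Lp ℝ 2 (volume.restrict F)) = ‖(p : Lp ℝ 2 (volume.restrict F))‖ ^ 2 := by
    rw [← Submodule.inner_orthogonalProjectionOnto_eq_of_mem_right p u, ← hp,
      real_inner_self_eq_norm_sq]
    rfl
  rw [h2, sq] at h1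
  rcases (norm_nonneg (p : Lp ℝ 2 (volume.restrict F))).eq_or_lt with h0 | h0
  · rw [← h0]; positivity
  · exact le_of_mul_le_mul_right h1 h0
end
end

section
/- Under the Geometry hypothesis, let H_𝒢 be the closure in L²(ℱ) of the set of restrictions to ℱ of functions that are harmonic on 𝒢 and square-integrable on 𝒢, with Π the orthogonal projection of L²(ℱ) onto H_𝒢. Then every function h that is harmonic on 𝒦 = ℝ² ∖ closure(𝒪), locally square-integrable on 𝒦, with h(x) → 0 as |x| → ∞, satisfies ‖h|_ℱ − Π(h|_ℱ)‖_{L²(ℱ_Γ)} ≤ 3√(δ_0/δ) · ‖h‖_{L²(ℱ)}; consequently, if δ > 4δ_0, then ‖h|_ℱ − Π(h|_ℱ)‖_{L²(ℱ_Γ)} ≤ 3√(δ_0/(δ − 4δ_0)) · ‖h|_ℱ − Π(h|_ℱ)‖_{L²(ℱ)}. (Estimates (3.36) in the proof of Theorem 3.8.) -/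
open MeasureTheory Metric Filter

noncomputable section

theorem aux_meanSq_mono (F : ℂ → ℂ) (R r s : ℝ) (hF : DifferentiableOn ℂ F (ball 0 R))
    (hr : 0 < r) (hrs : r ≤ s) (hs : s < R) :
    ∫ θ in (0:ℝ)..2 * Real.pi, ‖F (circleMap 0 r θ)‖ ^ 2 ≤
      ∫ θ in (0:ℝ)..2 * Real.pi, ‖F (circleMap 0 s θ)‖ ^ 2 := by
  have hpi := Real.pi_pos
  have hFa : AnalyticOnNhd ℂ F (ball 0 R) := hF.analyticOnNhd isOpen_ball
  have hFc : ContinuousOn F (ball 0 R) := hF.continuousOn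
  have hdF : ContinuousOn (deriv F) (ball 0 R) := hFa.deriv.continuousOn
  let e : ℝ → ℂ := fun θ => circleMap 0 1 θ
  have hec : Continuous e := continuous_circleMap 0 1
  have hen : ∀ θ, ‖e θ‖ = 1 := fun θ => by simp [e]
  have hmap : ∀ (t : ℝ) θ, circleMap 0 t θ = t * e θ := fun t θ => by simp [e, circleMap]
  have hcont : ∀ w ∈ ball (0:ℂ) R, Continuous fun θ => F (w * e θ) := by
    intro w hw
    refine hFc.comp_continuous (by fun_prop) ?_
    intro θ
    simpa [hen] using hw
  have hcontd : ∀ w ∈ ball (0:ℂ) R, Continuous fun θ => deriv F (w * e θ) := by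
    intro w hw
    refine hdF.comp_continuous (by fun_prop) ?_
    intro θ
    simpa [hen] using hw
  have hrR : (r:ℂ) ∈ ball (0:ℂ) R := by
    simp [abs_of_pos hr]; linarith
  let K : ℝ → ℂ := fun θ => (starRingEnd ℂ) (F (r * e θ))
  have hKc : Continuous K := by
    have := hcont _ hrR
    exact Complex.continuous_conj.comp this
  let ψ : ℂ → ℂ := fun w => ∫ θ in (0:ℝ)..2 * Real.pi, F (w * e θ) * K θ
  have hψ : DifferentiableOn ℂ ψ (ball 0 R) := by
    intro w hw
    apply DifferentiableAt.differentiableWithinAt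
    obtain ⟨ε, hε, hεR⟩ := exists_between (show ‖w‖ < R by simpa using hw)
    have hcomp : IsCompact (closedBall (0:ℂ) ε) := isCompact_closedBall _ _
    have hsub : closedBall (0:ℂ) ε ⊆ ball 0 R := closedBall_subset_ball hεR
    obtain ⟨C, hC⟩ := hcomp.exists_bound_of_continuousOn (hdF.mono hsub)
    have hCn : 0 ≤ C := (norm_nonneg _).trans (hC 0 (by simpa using (norm_nonneg w).trans hε.le))
    have := intervalIntegral.hasDerivAt_integral_of_dominated_loc_of_deriv_le
      (μ := volume) (a := 0) (b := 2 * Real.pi) (F := fun w θ => F (w * e θ) * K θ)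
      (F' := fun w θ => (deriv F (w * e θ) * e θ) * K θ) (x₀ := w) (s := ball 0 ε)
      (bound := fun θ => C * ‖K θ‖)
      (isOpen_ball.mem_nhds (by simpa using hε))
      (by
        filter_upwards [isOpen_ball.mem_nhds hw] with x hx
        exact ((hcont x hx).mul hKc).aestronglyMeasurable)
      (((hcont w hw).mul hKc).intervalIntegrable _ _)
      ((((hcontd w hw).mul hec).mul hKc).aestronglyMeasurable)
      (by
        refine Eventually.of_forall fun θ _ x hx => ?_
        rw [norm_mul, norm_mul, hen, mul_one]
        gcongr
        apply hC
        have : ‖x‖ < ε := by simpa using hx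
        simpa [hen] using this.le)
      ((continuous_const.mul hKc.norm).intervalIntegrable _ _)
      (by
        refine Eventually.of_forall fun θ _ x hx => ?_
        have hx' : x * e θ ∈ ball (0:ℂ) R := by
          apply hsub
          have : ‖x‖ < ε := by simpa using hx
          simpa [hen] using this.le
        have h1 : HasDerivAt F (deriv F (x * e θ)) (x * e θ) := (hFa _ hx').differentiableAt.hasDerivAt
        have h2 : HasDerivAt (fun y : ℂ => y * e θ) (e θ) x := by
          simpa using (hasDerivAt_id x).mul_const (e θ)
        exact (h1.comp x h2).mul_const (K θ))
    exact this.2.differentiableAt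
  set I : ℝ → ℝ := fun t => ∫ θ in (0:ℝ)..2 * Real.pi, ‖F (t * e θ)‖ ^ 2 with hI
  have hrot : ∀ w : ℂ, ‖w‖ = s → ∫ θ in (0:ℝ)..2 * Real.pi, ‖F (w * e θ)‖ ^ 2 = I s := by
    intro w hw
    have hw' : ∀ θ, w * e θ = (s:ℂ) * e (θ + Complex.arg w) := by
      intro θ
      conv_lhs => rw [← Complex.norm_mul_exp_arg_mul_I w, hw]
      simp only [e, circleMap_zero, Complex.ofReal_one, one_mul, Complex.ofReal_add, add_mul, Complex.exp_add]
      ring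
    simp_rw [hw', hI]
    have hper : Function.Periodic (fun θ => ‖F (s * e θ)‖ ^ 2) (2 * Real.pi) := by
      intro θ
      simp only [e]
      rw [periodic_circleMap 0 1 θ]
    rw [intervalIntegral.integral_comp_add_right (fun θ => ‖F (s * e θ)‖ ^ 2)]
    have := hper.intervalIntegral_add_eq (Complex.arg w) 0
    simp only [zero_add] at this ⊢
    rw [← this, add_comm]
  have hbound : ∀ w ∈ frontier (ball (0:ℂ) s), ‖ψ w‖ ≤ (I s + I r) / 2 := by
    intro w hw
    rw [frontier_ball _ (by linarith)] at hw
    have hw' : ‖w‖ = s := by simpa using hw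
    have hwR : w ∈ ball (0:ℂ) R := by simp [hw', hs]
    have h1 : ‖ψ w‖ ≤ ∫ θ in (0:ℝ)..2 * Real.pi, ‖F (w * e θ) * K θ‖ :=
      intervalIntegral.norm_integral_le_integral_norm (by positivity)
    have h2 : ∫ θ in (0:ℝ)..2 * Real.pi, ‖F (w * e θ) * K θ‖ ≤
        ∫ θ in (0:ℝ)..2 * Real.pi, (‖F (w * e θ)‖ ^ 2 + ‖F (r * e θ)‖ ^ 2) / 2 := by
      apply intervalIntegral.integral_mono (by positivity)
      · exact (((hcont w hwR).mul hKc).norm).intervalIntegrable _ _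
      · exact (((((hcont w hwR).norm.pow 2)).add ((hcont _ hrR).norm.pow 2)).div_const 2).intervalIntegrable _ _
      · intro θ
        simp only [norm_mul, K, RCLike.norm_conj]
        nlinarith [sq_nonneg (‖F (w * e θ)‖ - ‖F (r * e θ)‖)]
    have h3 : ∫ θ in (0:ℝ)..2 * Real.pi, (‖F (w * e θ)‖ ^ 2 + ‖F (r * e θ)‖ ^ 2) / 2 = (I s + I r) / 2 := by
      rw [intervalIntegral.integral_div, intervalIntegral.integral_add, hrot w hw']
      · exact ((hcont w hwR).norm.pow 2).intervalIntegrable _ _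
      · exact ((hcont _ hrR).norm.pow 2).intervalIntegrable _ _
    linarith
  have hmax : ‖ψ r‖ ≤ (I s + I r) / 2 := by
    refine Complex.norm_le_of_forall_mem_frontier_norm_le isBounded_ball ?_ hbound ?_
    · exact (hψ.mono (by
        rw [closure_ball _ (by linarith)]
        exact closedBall_subset_ball hs)).diffContOnCl
    · rw [closure_ball _ (by linarith)]
      simp [abs_of_pos hr, hrs]
  have hψr : ψ r = (I r : ℝ) := by
    simp only [ψ, hI, K]
    rw [← intervalIntegral.integral_ofReal]
    congr 1
    ext θ
    rw [Complex.mul_conj, Complex.normSq_eq_norm_sq]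
  rw [hψr, Complex.norm_real, Real.norm_eq_abs] at hmax
  have := le_abs_self (I r)
  simp_rw [hmap]
  change I r ≤ I s
  linarith

theorem aux_re_sq (F : ℂ → ℂ) (R r : ℝ) (hF : DifferentiableOn ℂ F (ball 0 R))
    (hr : 0 < r) (hs : r < R) :
    ∫ θ in (0:ℝ)..2 * Real.pi, (F (circleMap 0 r θ)).re ^ 2 =
      (∫ θ in (0:ℝ)..2 * Real.pi, ‖F (circleMap 0 r θ)‖ ^ 2) / 2 + Real.pi * ((F 0) ^ 2).re := by
  have hpi := Real.pi_pos
  have hmv : Real.circleAverage (fun z => (F z) ^ 2) 0 r = (F 0) ^ 2 := by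
    apply DiffContOnCl.circleAverage (f := fun z => (F z) ^ 2)
    rw [abs_of_pos hr]
    exact ((hF.pow 2).mono (by
        rw [closure_ball _ hr.ne']
        exact closedBall_subset_ball hs)).diffContOnCl
  have hcont : Continuous fun θ => F (circleMap 0 r θ) := by
    refine hF.continuousOn.comp_continuous (continuous_circleMap 0 r) ?_
    intro θ
    simp [abs_of_pos hr, hs]
  rw [Real.circleAverage_def] at hmv
  have h1 : ∫ θ in (0:ℝ)..2 * Real.pi, ((F (circleMap 0 r θ)) ^ 2).re = 2 * Real.pi * ((F 0) ^ 2).re := by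
    rw [← hmv]
    have := Complex.reCLM.intervalIntegral_comp_comm (μ := volume) (a := 0) (b := 2 * Real.pi)
      (f := fun θ => (F (circleMap 0 r θ)) ^ 2) ((hcont.pow 2).intervalIntegrable _ _)
    simp only [Complex.reCLM_apply] at this
    rw [this]
    simp
    field_simp
  have h2 : ∀ θ, (F (circleMap 0 r θ)).re ^ 2 =
      ‖F (circleMap 0 r θ)‖ ^ 2 / 2 + ((F (circleMap 0 r θ)) ^ 2).re / 2 := by
    intro θ
    rw [← Complex.normSq_eq_norm_sq, Complex.normSq_apply, sq (F _), Complex.mul_re]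
    ring
  simp_rw [h2]
  rw [intervalIntegral.integral_add, intervalIntegral.integral_div, intervalIntegral.integral_div, h1]
  · ring
  · exact ((hcont.norm.pow 2).div_const 2).intervalIntegrable _ _
  · exact ((Complex.continuous_re.comp (hcont.pow 2)).div_const 2).intervalIntegrable _ _

theorem aux_re_mono (F : ℂ → ℂ) (R r s : ℝ) (hF : DifferentiableOn ℂ F (ball 0 R))
    (hr : 0 < r) (hrs : r ≤ s) (hs : s < R) :
    ∫ θ in (0:ℝ)..2 * Real.pi, (F (circleMap 0 r θ)).re ^ 2 ≤
      ∫ θ in (0:ℝ)..2 * Real.pi, (F (circleMap 0 s θ)).re ^ 2 := by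
  rw [aux_re_sq F R r hF hr (by linarith), aux_re_sq F R s hF (by linarith) hs]
  have := aux_meanSq_mono F R r s hF hr hrs hs
  linarith

theorem aux_re_mono' (F : ℂ → ℂ) (R r s : ℝ) (hF : DifferentiableOn ℂ F (ball 0 R))
    (hr : 0 < r) (hrs : r ≤ s) (hs : s < R) (h0 : F 0 = 0) :
    (∫ θ in (0:ℝ)..2 * Real.pi, (F (circleMap 0 r θ)).re ^ 2) * s ^ 2 ≤
      (∫ θ in (0:ℝ)..2 * Real.pi, (F (circleMap 0 s θ)).re ^ 2) * r ^ 2 := by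
  rw [aux_re_sq F R r hF hr (by linarith), aux_re_sq F R s hF (by linarith) hs]
  have hd : DifferentiableOn ℂ (dslope F 0) (ball 0 R) :=
    (Complex.differentiableOn_dslope (isOpen_ball.mem_nhds (by simp; linarith))).2 hF
  have := aux_meanSq_mono _ R r s hd hr hrs hs
  have key : ∀ t : ℝ, 0 < t → ∫ θ in (0:ℝ)..2 * Real.pi, ‖F (circleMap 0 t θ)‖ ^ 2 =
      t ^ 2 * ∫ θ in (0:ℝ)..2 * Real.pi, ‖dslope F 0 (circleMap 0 t θ)‖ ^ 2 := by
    intro t ht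
    rw [← intervalIntegral.integral_const_mul]
    congr 1
    ext θ
    have h := sub_smul_dslope F 0 (circleMap 0 t θ)
    rw [h0, sub_zero, sub_zero] at h
    rw [← h, norm_smul, mul_pow]
    simp
  rw [key r hr, key s (by linarith), h0]
  simp only [ne_eq, OfNat.ofNat_ne_zero, not_false_eq_true, zero_pow, Complex.zero_re, mul_zero, add_zero]
  have : 0 ≤ r ^ 2 * s ^ 2 := by positivity
  nlinarith
open InnerProductSpace in
theorem aux_harm_inv (h : ℂ → ℝ) (w : ℂ) (hw : w ≠ 0) (hh : HarmonicAt h w⁻¹) :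
    HarmonicAt (fun z => h z⁻¹) w := by
  have hopen := isOpen_setOfPred_harmonicAt h
  obtain ⟨ε, hε, hsub⟩ := Metric.isOpen_iff.1 hopen w⁻¹ hh
  obtain ⟨F, hF, hre⟩ := HarmonicOnNhd.exists_analyticOnNhd_ball_re_eq (f := h) (z := w⁻¹) (R := ε)
    (fun x hx => hsub hx)
  have h1 : AnalyticAt ℂ (fun z => F z⁻¹) w :=
    AnalyticAt.fun_comp (hF _ (mem_ball_self hε)) (analyticAt_inv hw)
  refine (harmonicAt_congr_nhds ?_).1 h1.harmonicAt_re
  have : ∀ᶠ z in nhds w, z⁻¹ ∈ ball w⁻¹ ε :=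
    (continuousAt_inv₀ hw).eventually (isOpen_ball.mem_nhds (mem_ball_self hε))
  filter_upwards [this] with z hz
  exact hre hz

theorem aux_hasFDeriv_re (F : ℂ → ℂ) (w d : ℂ) (hF : HasDerivAt F d w) :
    HasFDerivAt (fun z => (F z).re)
      (Complex.reCLM.comp ((ContinuousLinearMap.toSpanSingleton ℂ d).restrictScalars ℝ)) w := by
  exact Complex.reCLM.hasFDerivAt.comp w (hF.hasFDerivAt.restrictScalars ℝ)

open InnerProductSpace in
theorem aux_repr (u : ℂ → ℝ) (R : ℝ) (hR : 0 < R) (hu : HarmonicOnNhd u (ball 0 R \ {0}))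
    (hlim : Tendsto u (nhdsWithin 0 {0}ᶜ) (nhds 0)) :
    ∃ Q : ℂ → ℂ, DifferentiableOn ℂ Q (ball 0 R) ∧ Q 0 = 0 ∧
      ∀ w ∈ ball (0:ℂ) R, w ≠ 0 → u w = (Q w).re := by
  set g : ℂ → ℂ := fun z => fderiv ℝ u z 1 - Complex.I * fderiv ℝ u z Complex.I with hg
  have hgd : DifferentiableOn ℂ g (ball 0 R \ {0}) := fun x hx =>
    (HarmonicAt.differentiableAt_complex_partial (hu x hx)).differentiableWithinAt
  have hgF : ∀ (F : ℂ → ℂ) (w d : ℂ), HasDerivAt F d w → (fun z => (F z).re) =ᶠ[nhds w] u → g w = d := by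
    intro F w d hF he
    have h1 := (aux_hasFDeriv_re F w d hF).congr_of_eventuallyEq he.symm
    simp only [hg, h1.fderiv]
    apply Complex.ext <;> simp
  have hbd : ∀ ε > 0, ∀ᶠ w in nhdsWithin (0:ℂ) {0}ᶜ, ‖g w‖ * ‖w‖ ≤ ε * (Real.exp 1 ^ 2 * 2) := by
    intro ε hε
    have h1 : ∀ᶠ w in nhdsWithin (0:ℂ) {0}ᶜ, |u w| < ε := by
      have := hlim.abs
      rw [abs_zero] at this
      exact this.eventually_lt_const hε
    rw [eventually_nhdsWithin_iff, Metric.eventually_nhds_iff_ball] at h1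
    obtain ⟨η, hη, h1⟩ := h1
    rw [eventually_nhdsWithin_iff, Metric.eventually_nhds_iff_ball]
    refine ⟨min η R / 2, by positivity, fun w hw hw0 => ?_⟩
    have hw0' : w ≠ 0 := by simpa using hw0
    have hwp : 0 < ‖w‖ := norm_pos_iff.2 hw0'
    have hw' : ‖w‖ < min η R / 2 := by simpa using hw
    have hmη := min_le_left η R
    have hmR := min_le_right η R
    have hsub : ∀ z ∈ ball w ‖w‖, z ≠ 0 ∧ z ∈ ball (0:ℂ) η ∧ z ∈ ball (0:ℂ) R := by
      intro z hz
      have hz' : ‖z - w‖ < ‖w‖ := by simpa [dist_eq_norm] using hz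
      have hz2 : ‖z‖ < 2 * ‖w‖ := by
        have := norm_add_le (z - w) w
        simp only [sub_add_cancel] at this
        linarith
      refine ⟨?_, ?_, ?_⟩
      · rintro rfl
        simp at hz'
      · simp; linarith
      · simp; linarith
    obtain ⟨F, hF, hre⟩ := HarmonicOnNhd.exists_analyticOnNhd_ball_re_eq (f := u) (z := w) (R := ‖w‖)
      (fun z hz => hu z ⟨(hsub z hz).2.2, (hsub z hz).1⟩)
    have hFw : HasDerivAt F (deriv F w) w := (hF w (mem_ball_self hwp)).differentiableAt.hasDerivAt
    have hgw : g w = deriv F w := hgF F w _ hFw (by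
      filter_upwards [isOpen_ball.mem_nhds (mem_ball_self hwp)] with z hz using hre hz)
    set E : ℂ → ℂ := fun z => Complex.exp (F z / ε) with hE
    have hEn : ∀ z ∈ ball w ‖w‖, ‖E z‖ = Real.exp (u z / ε) := by
      intro z hz
      simp only [hE, Complex.norm_exp]
      rw [← hre hz, Complex.div_ofReal_re]
    have hEd : DifferentiableOn ℂ E (ball w ‖w‖) :=
      (hF.differentiableOn.div_const _).cexp
    have hcl : closedBall w (‖w‖ / 2) ⊆ ball w ‖w‖ := closedBall_subset_ball (by linarith)
    have hderiv : ‖deriv E w‖ ≤ Real.exp 1 / (‖w‖ / 2) := by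
      apply Complex.norm_deriv_le_of_forall_mem_sphere_norm_le (by positivity)
      · apply DifferentiableOn.diffContOnCl
        rw [closure_ball _ (by positivity)]
        exact hEd.mono hcl
      · intro z hz
        have hz' := hcl (sphere_subset_closedBall hz)
        rw [hEn z hz', Real.exp_le_exp, div_le_one hε]
        exact (le_abs_self _).trans (h1 z (hsub z hz').2.1 (hsub z hz').1).le
    have hE' : deriv E w = E w * (deriv F w / ε) := by
      have := (hFw.div_const (ε:ℂ)).cexp
      exact this.deriv
    rw [hE', norm_mul, hEn w (mem_ball_self hwp), norm_div, Complex.norm_real, Real.norm_of_nonneg hε.le] at hderiv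
    have hlow : Real.exp (-1) ≤ Real.exp (u w / ε) := by
      rw [Real.exp_le_exp, le_div_iff₀ hε]
      have := (abs_lt.1 (h1 w (hsub w (mem_ball_self hwp)).2.1 hw0')).1
      linarith
    have h3 : Real.exp (-1) * (‖deriv F w‖ / ε) ≤ Real.exp 1 / (‖w‖ / 2) :=
      (mul_le_mul_of_nonneg_right hlow (by positivity)).trans hderiv
    rw [hgw]
    rw [Real.exp_neg, inv_mul_le_iff₀ (Real.exp_pos 1), div_le_iff₀ hε] at h3
    calc ‖deriv F w‖ * ‖w‖ ≤ (Real.exp 1 * (Real.exp 1 / (‖w‖ / 2)) * ε) * ‖w‖ := by gcongr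
      _ = _ := by field_simp
  have ho : (fun z => g z - g 0) =o[nhdsWithin (0:ℂ) {0}ᶜ] fun z => (z - 0)⁻¹ := by
    rw [Asymptotics.isLittleO_iff]
    intro ε hε
    have h2 : ∀ᶠ w in nhdsWithin (0:ℂ) {0}ᶜ, ‖w‖ * ‖g 0‖ < ε / 2 := by
      have : Tendsto (fun w : ℂ => ‖w‖ * ‖g 0‖) (nhds 0) (nhds 0) := by
        have : Continuous (fun w : ℂ => ‖w‖ * ‖g 0‖) := by fun_prop
        simpa using this.tendsto 0
      exact (this.mono_left nhdsWithin_le_nhds).eventually_lt_const (by positivity)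
    filter_upwards [hbd (ε / (4 * Real.exp 1 ^ 2)) (by positivity), h2, self_mem_nhdsWithin] with w h1 h2 h3
    have hw0' : w ≠ 0 := by simpa using h3
    have hwp : 0 < ‖w‖ := norm_pos_iff.2 hw0'
    rw [sub_zero, norm_inv, ← div_eq_mul_inv, le_div_iff₀ hwp]
    have h4 : ε / (4 * Real.exp 1 ^ 2) * (Real.exp 1 ^ 2 * 2) = ε / 2 := by field_simp; norm_num
    rw [h4] at h1
    calc ‖g w - g 0‖ * ‖w‖ ≤ (‖g w‖ + ‖g 0‖) * ‖w‖ := by gcongr; exact norm_sub_le _ _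
      _ ≤ ε := by linarith
  have hrem := Complex.differentiableOn_update_limUnder_of_isLittleO (isOpen_ball.mem_nhds (mem_ball_self hR)) hgd ho
  obtain ⟨Q, hQ0, hQ⟩ := hrem.isExactOn_ball.with_val_at 0 0
  have hQd : DifferentiableOn ℂ Q (ball 0 R) := fun x hx => (hQ x hx).differentiableAt.differentiableWithinAt
  refine ⟨Q, hQd, hQ0, fun w hw hw0 => ?_⟩
  have hwn : ‖w‖ < R := by simpa using hw
  set v : ℂ → ℝ := fun z => if z = 0 then 0 else u z - (Q z).re with hv
  have hin : ∀ t ∈ Set.Ioc (0:ℝ) 1, (t:ℂ) * w ∈ ball (0:ℂ) R \ {0} := by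
    intro t ht
    refine ⟨?_, ?_⟩
    · simp [abs_of_pos ht.1]
      have := mul_le_mul_of_nonneg_right ht.2 (norm_nonneg w)
      linarith
    · simp [hw0, ht.1.ne']
  have hvd : ∀ z ∈ ball (0:ℂ) R \ {0}, HasFDerivAt v (0 : ℂ →L[ℝ] ℝ) z := by
    intro z hz
    have hz0 : z ≠ 0 := hz.2
    have hud : HasFDerivAt u (fderiv ℝ u z) z := ((hu z hz).1.differentiableAt (by norm_num)).hasFDerivAt
    have hQz := hQ z hz.1
    rw [Function.update_of_ne hz0] at hQz
    have h1 := hud.sub (aux_hasFDeriv_re Q z _ hQz)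
    have h2 : fderiv ℝ u z - (Complex.reCLM.comp ((ContinuousLinearMap.toSpanSingleton ℂ (g z)).restrictScalars ℝ)) = 0 := by
      have hlin : ∀ y : ℂ, fderiv ℝ u z y = y.re * fderiv ℝ u z 1 + y.im * fderiv ℝ u z Complex.I := by
        intro y
        conv_lhs => rw [show y = (y.re:ℝ) • (1:ℂ) + (y.im:ℝ) • Complex.I by
          simp [Complex.re_add_im]]
        rw [map_add, map_smul, map_smul]
        simp
      ext y
      rw [sub_apply, hlin y]
      simp [hg]
    rw [h2] at h1
    refine h1.congr_of_eventuallyEq ?_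
    filter_upwards [isOpen_ne.mem_nhds hz0] with y hy
    have hy' : y ≠ 0 := hy
    simp [hv, hy']
  have hvc0 : ContinuousAt v 0 := by
    rw [← continuousWithinAt_compl_self, ContinuousWithinAt]
    have hQc : ContinuousAt Q 0 := (hQ 0 (mem_ball_self hR)).continuousAt
    have hq : Tendsto (fun z => (Q z).re) (nhdsWithin 0 {0}ᶜ) (nhds 0) := by
      have := (Complex.continuous_re.continuousAt.comp hQc).tendsto
      simp only [Function.comp, hQ0, Complex.zero_re] at this
      exact this.mono_left nhdsWithin_le_nhds
    have h3 := hlim.sub hq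
    have hv0 : v 0 = 0 - 0 := by simp [hv]
    rw [hv0]
    refine h3.congr' ?_
    filter_upwards [self_mem_nhdsWithin] with y hy
    have hy' : y ≠ 0 := hy
    simp [hv, hy']
  have hmvt := exists_hasDerivAt_eq_slope (fun t : ℝ => v (t * w)) (fun _ => 0) (a := 0) (b := 1) one_pos
    (by
      intro t ht
      apply ContinuousAt.continuousWithinAt
      have hl : ContinuousAt (fun t : ℝ => (t:ℂ) * w) t := by fun_prop
      have : ContinuousAt v ((t:ℂ) * w) := by
        rcases ht.1.eq_or_lt with h | h
        · subst h; simpa using hvc0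
        · exact (hvd _ (hin t ⟨h, ht.2⟩)).continuousAt
      exact ContinuousAt.comp (f := fun t : ℝ => (t:ℂ) * w) (g := v) this hl)
    (by
      intro t ht
      have h1 := hvd _ (hin t ⟨ht.1, ht.2.le⟩)
      have h2 : HasDerivAt (fun t : ℝ => (t:ℂ) * w) w t := by
        simpa using (Complex.ofRealCLM.hasDerivAt (x := t)).mul_const w
      have := h1.comp_hasDerivAt t h2
      simp only [zero_apply] at this
      exact this)
  obtain ⟨_, _, h⟩ := hmvt
  simp [hv, hw0] at h
  linarith

theorem aux_polar (f : ℂ → ENNReal) (hf : Measurable f) (S : Set ℝ) (hS : MeasurableSet S) :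
    ∫⁻ z in {z : ℂ | ‖z‖ ∈ S}, f z =
      ∫⁻ r in S ∩ Set.Ioi 0, ENNReal.ofReal r *
        ∫⁻ θ in Set.Ioo (-Real.pi) Real.pi, f (circleMap 0 r θ) := by
  have hA : MeasurableSet {z : ℂ | ‖z‖ ∈ S} := measurable_norm hS
  rw [← lintegral_indicator hA, ← Complex.lintegral_comp_polarCoord_symm]
  have hsymm : ∀ p : ℝ × ℝ, Complex.polarCoord.symm p = circleMap 0 p.1 p.2 := by
    intro p
    rw [Complex.polarCoord_symm_apply, circleMap_zero, Complex.exp_mul_I]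
    simp
  simp_rw [hsymm]
  rw [polarCoord_target, Measure.volume_eq_prod, ← Measure.prod_restrict, lintegral_prod]
  · rw [Set.inter_comm, ← Measure.restrict_restrict_of_subset (s := Set.Ioi (0:ℝ) ∩ S) (t := Set.Ioi 0) Set.inter_subset_left,
      ← lintegral_indicator (measurableSet_Ioi.inter hS)]
    apply setLIntegral_congr_fun measurableSet_Ioi
    intro r hr
    have hr' : (0:ℝ) < r := hr
    simp only [smul_eq_mul]
    by_cases h : r ∈ S
    · rw [Set.indicator_of_mem (show r ∈ Set.Ioi (0:ℝ) ∩ S from ⟨hr, h⟩), lintegral_const_mul]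
      · congr 1
        apply lintegral_congr
        intro θ
        rw [Set.indicator_of_mem]
        simpa [abs_of_pos hr'] using h
      · exact (hf.indicator hA).comp (continuous_circleMap 0 r).measurable
    · rw [Set.indicator_of_notMem (show r ∉ Set.Ioi (0:ℝ) ∩ S from fun h' => h h'.2)]
      rw [lintegral_eq_zero_iff']
      · refine Eventually.of_forall fun θ => ?_
        simp only [Pi.zero_apply]
        rw [Set.indicator_of_notMem, mul_zero]
        simpa [abs_of_pos hr'] using h
      · exact (((hf.indicator hA).comp (continuous_circleMap 0 r).measurable).const_mul _).aemeasurable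
  · apply Measurable.aemeasurable
    have : Measurable fun p : ℝ × ℝ => circleMap 0 p.1 p.2 := by
      unfold circleMap; fun_prop
    exact (ENNReal.measurable_ofReal.comp measurable_fst).smul ((hf.indicator hA).comp this)

theorem aux_angular (u : ℂ → ℝ) (r : ℝ) (hc : Continuous fun θ => u (circleMap 0 r θ)) :
    ∫⁻ θ in Set.Ioo (-Real.pi) Real.pi, ‖u (circleMap 0 r θ)‖ₑ ^ 2 =
      ENNReal.ofReal (∫ θ in (0:ℝ)..2 * Real.pi, u (circleMap 0 r θ) ^ 2) := by
  have hpi := Real.pi_pos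
  have h1 : ∫ θ in (0:ℝ)..2 * Real.pi, u (circleMap 0 r θ) ^ 2 =
      ∫ θ in (-Real.pi)..Real.pi, u (circleMap 0 r θ) ^ 2 := by
    have hper : Function.Periodic (fun θ => u (circleMap 0 r θ) ^ 2) (2 * Real.pi) := by
      intro θ
      simp only
      rw [periodic_circleMap 0 r θ]
    have := hper.intervalIntegral_add_eq 0 (-Real.pi)
    rw [zero_add, show -Real.pi + 2 * Real.pi = Real.pi by ring] at this
    exact this
  rw [h1, intervalIntegral.integral_of_le (by linarith), integral_Ioc_eq_integral_Ioo,
    ofReal_integral_eq_lintegral_ofReal]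
  · apply lintegral_congr
    intro θ
    rw [← enorm_pow, Real.enorm_of_nonneg (sq_nonneg _)]
  · exact ((hc.pow 2).integrableOn_Icc).mono_set Set.Ioo_subset_Icc_self
  · exact Eventually.of_forall fun θ => sq_nonneg _

theorem aux_lint_inv (a b : ℝ) (ha : 0 < a) (hab : a ≤ b) :
    ∫⁻ r in Set.Ioc a b, ENNReal.ofReal (r⁻¹) = ENNReal.ofReal (Real.log (b / a)) := by
  rw [← integral_inv_of_pos ha (by linarith), intervalIntegral.integral_of_le hab,
    ofReal_integral_eq_lintegral_ofReal]
  · refine (intervalIntegrable_iff_integrableOn_Ioc_of_le hab).1 ?_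
    apply ContinuousOn.intervalIntegrable
    apply ContinuousOn.inv₀ continuousOn_id
    intro x hx
    rw [Set.uIcc_of_le hab] at hx
    simp; linarith [hx.1]
  · rw [EventuallyLE, ae_restrict_iff' measurableSet_Ioc]
    refine Eventually.of_forall fun r hr => ?_
    have := hr.1
    simp; linarith

theorem aux_lint_id (a b : ℝ) (ha : 0 ≤ a) (hab : a ≤ b) :
    ∫⁻ r in Set.Ioc a b, ENNReal.ofReal r = ENNReal.ofReal ((b ^ 2 - a ^ 2) / 2) := by
  rw [← integral_id, intervalIntegral.integral_of_le hab,
    ofReal_integral_eq_lintegral_ofReal]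
  · refine (intervalIntegrable_iff_integrableOn_Ioc_of_le hab).1 ?_
    exact continuous_id.intervalIntegrable _ _
  · rw [EventuallyLE, ae_restrict_iff' measurableSet_Ioc]
    refine Eventually.of_forall fun r hr => ?_
    have := hr.1
    simp; linarith

theorem aux_ext (u : ℂ → ℝ) (hu : Measurable u) (a b d : ℝ) (ha : 0 < a) (hab : a < b) (hbd : b < d)
    (hc : ∀ r, a < r → Continuous fun θ => u (circleMap 0 r θ))
    (hmono : ∀ r s, a < r → r ≤ s → (∫ θ in (0:ℝ)..2 * Real.pi, u (circleMap 0 s θ) ^ 2) * s ^ 2 ≤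
      (∫ θ in (0:ℝ)..2 * Real.pi, u (circleMap 0 r θ) ^ 2) * r ^ 2) :
    ENNReal.ofReal (Real.log (b / a)) * ∫⁻ z in {z : ℂ | ‖z‖ ∈ Set.Ioc b d}, ‖u z‖ₑ ^ 2 ≤
      ENNReal.ofReal (Real.log (d / b)) * ∫⁻ z in {z : ℂ | ‖z‖ ∈ Set.Ioc a b}, ‖u z‖ₑ ^ 2 := by
  have hf : Measurable fun z => ‖u z‖ₑ ^ 2 := by fun_prop
  have hb : 0 < b := ha.trans hab
  rw [aux_polar _ hf _ measurableSet_Ioc, aux_polar _ hf _ measurableSet_Ioc]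
  set J : ℝ → ℝ := fun r => ∫ θ in (0:ℝ)..2 * Real.pi, u (circleMap 0 r θ) ^ 2 with hJ
  have e1 : Set.Ioc b d ∩ Set.Ioi 0 = Set.Ioc b d :=
    Set.inter_eq_left.2 fun x hx => hb.trans hx.1
  have e2 : Set.Ioc a b ∩ Set.Ioi 0 = Set.Ioc a b :=
    Set.inter_eq_left.2 fun x hx => ha.trans hx.1
  rw [e1, e2]
  set K := ENNReal.ofReal (J b * b ^ 2) with hK
  have hJ0 : ∀ r, 0 ≤ J r := fun r => intervalIntegral.integral_nonneg (by positivity) fun _ _ => sq_nonneg _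
  have h1 : ∫⁻ r in Set.Ioc b d, ENNReal.ofReal r *
        ∫⁻ θ in Set.Ioo (-Real.pi) Real.pi, ‖u (circleMap 0 r θ)‖ₑ ^ 2 ≤ K * ENNReal.ofReal (Real.log (d / b)) := by
    rw [← aux_lint_inv b d hb hbd.le, ← lintegral_const_mul _ (by fun_prop)]
    apply setLIntegral_mono' measurableSet_Ioc
    intro r hr
    have hr0 : 0 < r := hb.trans hr.1
    rw [aux_angular u r (hc r (hab.trans hr.1)), hK, ← ENNReal.ofReal_mul hr0.le,
      ← ENNReal.ofReal_mul (mul_nonneg (hJ0 _) (sq_nonneg _))]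
    apply ENNReal.ofReal_le_ofReal
    rw [← div_eq_mul_inv, le_div_iff₀ hr0]
    have := hmono b r hab hr.1.le
    simp only [hJ]
    nlinarith
  have h2 : K * ENNReal.ofReal (Real.log (b / a)) ≤ ∫⁻ r in Set.Ioc a b, ENNReal.ofReal r *
        ∫⁻ θ in Set.Ioo (-Real.pi) Real.pi, ‖u (circleMap 0 r θ)‖ₑ ^ 2 := by
    rw [← aux_lint_inv a b ha hab.le, ← lintegral_const_mul _ (by fun_prop)]
    apply setLIntegral_mono' measurableSet_Ioc
    intro r hr
    have hr0 : 0 < r := ha.trans hr.1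
    rw [aux_angular u r (hc r hr.1), hK, ← ENNReal.ofReal_mul hr0.le,
      ← ENNReal.ofReal_mul (mul_nonneg (hJ0 _) (sq_nonneg _))]
    apply ENNReal.ofReal_le_ofReal
    rw [← div_eq_mul_inv, div_le_iff₀ hr0]
    have := hmono r b hr.1 hr.2
    simp only [hJ]
    nlinarith
  calc _ ≤ ENNReal.ofReal (Real.log (b / a)) * (K * ENNReal.ofReal (Real.log (d / b))) := by gcongr
    _ = ENNReal.ofReal (Real.log (d / b)) * (K * ENNReal.ofReal (Real.log (b / a))) := by ring
    _ ≤ _ := by gcongr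

theorem aux_int (u : ℂ → ℝ) (hu : Measurable u) (b d : ℝ) (hb : 0 < b) (hbd : b < d)
    (hc : ∀ r, 0 < r → r < d → Continuous fun θ => u (circleMap 0 r θ))
    (hmono : ∀ r s, 0 < r → r ≤ s → s < d → (∫ θ in (0:ℝ)..2 * Real.pi, u (circleMap 0 r θ) ^ 2) ≤
      (∫ θ in (0:ℝ)..2 * Real.pi, u (circleMap 0 s θ) ^ 2)) :
    ENNReal.ofReal (d ^ 2 - b ^ 2) * ∫⁻ z in {z : ℂ | ‖z‖ ∈ Set.Iic b}, ‖u z‖ₑ ^ 2 ≤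
      ENNReal.ofReal (b ^ 2) * ∫⁻ z in {z : ℂ | ‖z‖ ∈ Set.Ioo b d}, ‖u z‖ₑ ^ 2 := by
  have hf : Measurable fun z => ‖u z‖ₑ ^ 2 := by fun_prop
  rw [aux_polar _ hf _ measurableSet_Iic, aux_polar _ hf _ measurableSet_Ioo]
  set J : ℝ → ℝ := fun r => ∫ θ in (0:ℝ)..2 * Real.pi, u (circleMap 0 r θ) ^ 2 with hJ
  have e1 : Set.Iic b ∩ Set.Ioi 0 = Set.Ioc 0 b := by
    rw [Set.inter_comm, Set.Ioi_inter_Iic]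
  have e2 : Set.Ioo b d ∩ Set.Ioi 0 = Set.Ioo b d :=
    Set.inter_eq_left.2 fun x hx => hb.trans hx.1
  rw [e1, e2]
  set K := ENNReal.ofReal (J b) with hK
  have hJ0 : ∀ r, 0 ≤ J r := fun r => intervalIntegral.integral_nonneg (by positivity) fun _ _ => sq_nonneg _
  have h1 : ∫⁻ r in Set.Ioc 0 b, ENNReal.ofReal r *
        ∫⁻ θ in Set.Ioo (-Real.pi) Real.pi, ‖u (circleMap 0 r θ)‖ₑ ^ 2 ≤ K * ENNReal.ofReal ((b ^ 2 - 0 ^ 2) / 2) := by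
    rw [← aux_lint_id 0 b le_rfl hb.le, ← lintegral_const_mul _ (by fun_prop)]
    apply setLIntegral_mono' measurableSet_Ioc
    intro r hr
    rw [aux_angular u r (hc r hr.1 (by linarith [hr.2])), mul_comm]
    gcongr
    exact ENNReal.ofReal_le_ofReal (hmono r b hr.1 hr.2 hbd)
  have h2 : K * ENNReal.ofReal ((d ^ 2 - b ^ 2) / 2) ≤ ∫⁻ r in Set.Ioo b d, ENNReal.ofReal r *
        ∫⁻ θ in Set.Ioo (-Real.pi) Real.pi, ‖u (circleMap 0 r θ)‖ₑ ^ 2 := by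
    rw [← aux_lint_id b d hb.le hbd.le, ← lintegral_const_mul _ (by fun_prop), restrict_Ioo_eq_restrict_Ioc.symm]
    apply setLIntegral_mono' measurableSet_Ioo
    intro r hr
    rw [aux_angular u r (hc r (hb.trans hr.1) hr.2), mul_comm]
    gcongr
    exact ENNReal.ofReal_le_ofReal (hmono b r hb hr.1.le hr.2)
  have e3 : ENNReal.ofReal (d ^ 2 - b ^ 2) = ENNReal.ofReal 2 * ENNReal.ofReal ((d ^ 2 - b ^ 2) / 2) := by
    rw [← ENNReal.ofReal_mul (by norm_num)]; congr 1; ring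
  have e4 : ENNReal.ofReal (b ^ 2) = ENNReal.ofReal 2 * ENNReal.ofReal ((b ^ 2 - 0 ^ 2) / 2) := by
    rw [← ENNReal.ofReal_mul (by norm_num)]; congr 1; ring
  calc _ ≤ ENNReal.ofReal (d ^ 2 - b ^ 2) * (K * ENNReal.ofReal ((b ^ 2 - 0 ^ 2) / 2)) := by gcongr
    _ = ENNReal.ofReal (b ^ 2) * (K * ENNReal.ofReal ((d ^ 2 - b ^ 2) / 2)) := by rw [e3, e4]; ring
    _ ≤ _ := by gcongr

abbrev auxE : ℂ ≃ₗᵢ[ℝ] Pt := Complex.orthonormalBasisOneI.repr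

def auxPhi (c : Pt) (z : ℂ) : Pt := c + auxE z

theorem auxPhi_cont (c : Pt) : Continuous (auxPhi c) := by
  unfold auxPhi
  exact continuous_const.add auxE.continuous

theorem auxPhi_dist (c : Pt) (z : ℂ) : dist (auxPhi c z) c = ‖z‖ := by
  rw [dist_eq_norm, auxPhi, add_sub_cancel_left, LinearIsometryEquiv.norm_map]

theorem auxPhi_mp (c : Pt) : MeasurePreserving (auxPhi c) volume volume :=
  (measurePreserving_add_left volume c).comp (auxE.measurePreserving)

theorem auxPhi_lint (c : Pt) (S : Set ℝ) (hS : MeasurableSet S) (f : Pt → ENNReal) :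
    ∫⁻ x in {x : Pt | dist x c ∈ S}, f x = ∫⁻ z in {z : ℂ | ‖z‖ ∈ S}, f (auxPhi c z) := by
  have hemb : MeasurableEmbedding (auxPhi c) :=
    (Homeomorph.addLeft c).measurableEmbedding.comp auxE.toHomeomorph.measurableEmbedding
  rw [← (auxPhi_mp c).setLIntegral_comp_preimage_emb hemb]
  congr 2
  ext z
  simp [auxPhi_dist]

open InnerProductSpace in
theorem aux_transfer (f : Pt → ℝ) (U : Set Pt) (hU : IsOpen U) (c : Pt) (hf : IsHarmonicOn f U) :
    HarmonicOnNhd (fun z => f (auxPhi c z)) (auxPhi c ⁻¹' U) := by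
  have hL : ∀ z, Laplacian.laplacian (fun z => f (auxPhi c z)) z = lap f (auxPhi c z) := by
    intro z
    rw [laplacian_eq_iteratedFDeriv_orthonormalBasis _ Complex.orthonormalBasisOneI]
    simp only [lap]
    apply Finset.sum_congr rfl
    intro i _
    have h1 : (fun z => f (auxPhi c z)) = (fun x => f (c + x)) ∘ (auxE.toContinuousLinearEquiv) := rfl
    rw [h1]
    have h2 := auxE.toContinuousLinearEquiv.iteratedFDerivWithin_comp_right (𝕜 := ℝ)
      (fun x => f (c + x)) uniqueDiffOn_univ (x := z) (Set.mem_univ _) 2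
    simp only [Set.preimage_univ, iteratedFDerivWithin_univ] at h2
    rw [h2, ContinuousMultilinearMap.compContinuousLinearMap_apply, iteratedFDeriv_comp_add_left]
    congr 1
    ext j k
    fin_cases j <;> fin_cases i <;> fin_cases k <;> simp [auxE]
  have hopen : IsOpen (auxPhi c ⁻¹' U) := hU.preimage (auxPhi_cont c)
  intro z hz
  refine ⟨?_, ?_⟩
  · have h1 : ContDiffAt ℝ 2 f (auxPhi c z) := hf.1.contDiffAt (hU.mem_nhds hz)
    refine h1.comp z ?_
    unfold auxPhi
    exact contDiffAt_const.add auxE.contDiff.contDiffAt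
  · filter_upwards [hopen.mem_nhds hz] with y hy
    rw [hL]
    exact hf.2 _ hy

open InnerProductSpace in
theorem aux_ext_pt (h : Pt → ℝ) (c : Pt) (U : Set Pt) (hU : IsOpen U) (hh : IsHarmonicOn h U)
    (hlim : Tendsto h (cocompact Pt) (nhds 0)) (a b d : ℝ) (ha : 0 < a) (hab : a < b) (hbd : b < d)
    (haU : ∀ x, a ≤ dist x c → x ∈ U) :
    ENNReal.ofReal (Real.log (b / a)) * ∫⁻ x in {x : Pt | dist x c ∈ Set.Ioc b d}, ‖h x‖ₑ ^ 2 ≤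
      ENNReal.ofReal (Real.log (d / b)) * ∫⁻ x in {x : Pt | dist x c ∈ Set.Ioc a b}, ‖h x‖ₑ ^ 2 := by
  have hharm := aux_transfer h U hU c hh
  set u0 : ℂ → ℝ := fun z => h (auxPhi c z) with hu0
  have hmemU : ∀ z : ℂ, a ≤ ‖z‖ → z ∈ auxPhi c ⁻¹' U := fun z hz => haU _ (by rwa [auxPhi_dist])
  obtain ⟨Q, hQ, hQ0, hQre⟩ := aux_repr (fun w => u0 w⁻¹) a⁻¹ (by positivity)
    (by
      rintro w ⟨hw, hw0⟩
      have hw0' : w ≠ 0 := hw0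
      have hwp : 0 < ‖w‖ := norm_pos_iff.2 hw0'
      apply aux_harm_inv _ _ hw0'
      apply hharm
      apply hmemU
      rw [norm_inv]
      have : ‖w‖ < a⁻¹ := by simpa using hw
      exact ((lt_inv_comm₀ hwp ha).1 this).le)
    (by
      have h1 : Tendsto (fun w : ℂ => w⁻¹) (nhdsWithin 0 {0}ᶜ) (cocompact ℂ) := tendsto_inv₀_nhdsNE_zero.mono_right (by rw [Metric.cobounded_eq_cocompact])
      have h2 : Tendsto (auxPhi c) (cocompact ℂ) (cocompact Pt) :=
        ((Homeomorph.addLeft c).isClosedEmbedding.tendsto_cocompact).comp auxE.toHomeomorph.isClosedEmbedding.tendsto_cocompact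
      exact hlim.comp (h2.comp h1))
  have hrep : ∀ z : ℂ, a < ‖z‖ → u0 z = (Q z⁻¹).re := by
    intro z hz
    have hzp : 0 < ‖z‖ := ha.trans hz
    have := hQre z⁻¹ (by simp; exact (inv_lt_inv₀ hzp ha).2 hz) (inv_ne_zero (norm_pos_iff.1 hzp))
    simpa using this
  have hcirc : ∀ r θ, (circleMap 0 r θ)⁻¹ = circleMap 0 r⁻¹ (-θ) := by
    intro r θ
    simp [circleMap_zero, mul_inv, ← Complex.exp_neg]
    ring
  have hnorm : ∀ r θ, 0 < r → ‖circleMap 0 r θ‖ = r := by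
    intro r θ hr
    simp [abs_of_pos hr]
  have hcu0 : ContinuousOn u0 (auxPhi c ⁻¹' U) := hharm.continuousOn
  classical
  have hmeas : MeasurableSet (auxPhi c ⁻¹' U) := (hU.preimage (auxPhi_cont c)).measurableSet
  set u : ℂ → ℝ := (auxPhi c ⁻¹' U).indicator u0 with hu
  have hum : Measurable u := by
    rw [hu, ← Set.piecewise_eq_indicator]
    exact hcu0.measurable_piecewise continuousOn_const hmeas
  have huu : ∀ z, a ≤ ‖z‖ → u z = u0 z := fun z hz => Set.indicator_of_mem (hmemU z hz) _
  have hJ : ∀ r, a < r → ∫ θ in (0:ℝ)..2 * Real.pi, u (circleMap 0 r θ) ^ 2 =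
      ∫ θ in (0:ℝ)..2 * Real.pi, (Q (circleMap 0 r⁻¹ θ)).re ^ 2 := by
    intro r hr
    have e1 : ∀ θ, u (circleMap 0 r θ) ^ 2 = (Q (circleMap 0 r⁻¹ (-θ))).re ^ 2 := by
      intro θ
      have := hnorm r θ (ha.trans hr)
      rw [huu _ (by linarith), hrep _ (by linarith), hcirc]
    simp_rw [e1]
    rw [intervalIntegral.integral_comp_neg (fun θ => (Q (circleMap 0 r⁻¹ θ)).re ^ 2)]
    have hper : Function.Periodic (fun θ => (Q (circleMap 0 r⁻¹ θ)).re ^ 2) (2 * Real.pi) := by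
      intro θ
      simp only
      rw [periodic_circleMap 0 r⁻¹ θ]
    have := hper.intervalIntegral_add_eq (-(2 * Real.pi)) 0
    simpa using this
  have key := aux_ext u hum a b d ha hab hbd
    (by
      intro r hr
      have e1 : (fun θ => u (circleMap 0 r θ)) = fun θ => u0 (circleMap 0 r θ) := by
        ext θ
        apply huu
        rw [hnorm r θ (ha.trans hr)]; exact hr.le
      rw [e1]
      refine hcu0.comp_continuous (continuous_circleMap 0 r) fun θ => ?_
      apply hmemU
      rw [hnorm r θ (ha.trans hr)]; exact hr.le)
    (by
      intro r s hr hrs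
      have hr0 := ha.trans hr
      have hs0 := hr0.trans_le hrs
      rw [hJ r hr, hJ s (by linarith)]
      have := aux_re_mono' Q a⁻¹ s⁻¹ r⁻¹ hQ (by positivity) ((inv_le_inv₀ hs0 hr0).2 hrs)
        ((inv_lt_inv₀ hr0 ha).2 hr) hQ0
      have h1 : 0 < r ^ 2 := by positivity
      have h2 : 0 < s ^ 2 := by positivity
      rw [inv_pow, inv_pow, ← div_eq_mul_inv, ← div_eq_mul_inv, div_le_div_iff₀ h1 h2] at this
      exact this)
  rw [auxPhi_lint c _ measurableSet_Ioc, auxPhi_lint c _ measurableSet_Ioc]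
  have hset : ∀ p q : ℝ, a ≤ p → ∫⁻ z in {z : ℂ | ‖z‖ ∈ Set.Ioc p q}, ‖h (auxPhi c z)‖ₑ ^ 2 =
      ∫⁻ z in {z : ℂ | ‖z‖ ∈ Set.Ioc p q}, ‖u z‖ₑ ^ 2 := by
    intro p q hp
    apply setLIntegral_congr_fun (measurable_norm measurableSet_Ioc)
    intro z hz
    have hz' : p < ‖z‖ := hz.1
    simp only
    rw [huu z (by linarith)]
  rw [hset b d hab.le, hset a b le_rfl]
  exact key

open InnerProductSpace in
theorem aux_int_pt (g : Pt → ℝ) (c : Pt) (b d : ℝ) (hb : 0 < b) (hbd : b < d)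
    (hg : HarmonicOnNhd (fun z => g (auxPhi c z)) (ball 0 d)) :
    ENNReal.ofReal (d ^ 2 - b ^ 2) * ∫⁻ x in {x : Pt | dist x c ∈ Set.Iic b}, ‖g x‖ₑ ^ 2 ≤
      ENNReal.ofReal (b ^ 2) * ∫⁻ x in {x : Pt | dist x c ∈ Set.Ioo b d}, ‖g x‖ₑ ^ 2 := by
  set u0 : ℂ → ℝ := fun z => g (auxPhi c z) with hu0
  obtain ⟨F, hF, hre⟩ := hg.exists_analyticOnNhd_ball_re_eq
  have hcu0 : ContinuousOn u0 (ball 0 d) := hg.continuousOn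
  classical
  set u : ℂ → ℝ := (ball 0 d).indicator u0 with hu
  have hum : Measurable u := by
    rw [hu, ← Set.piecewise_eq_indicator]
    exact hcu0.measurable_piecewise continuousOn_const measurableSet_ball
  have huu : ∀ z, ‖z‖ < d → u z = u0 z := fun z hz => Set.indicator_of_mem (by simpa using hz) _
  have huF : ∀ z, ‖z‖ < d → u z = (F z).re := fun z hz => by
    rw [huu z hz]; exact (hre (by simpa using hz)).symm
  have hnorm : ∀ r θ, 0 < r → ‖circleMap 0 r θ‖ = r := by
    intro r θ hr
    simp [abs_of_pos hr]
  have hJ : ∀ r, 0 < r → r < d → (fun θ => u (circleMap 0 r θ)) =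
      fun θ => (F (circleMap 0 r θ)).re := by
    intro r hr hrd
    ext θ
    exact huF _ (by rw [hnorm r θ hr]; exact hrd)
  have hFd : DifferentiableOn ℂ F (ball 0 d) := hF.differentiableOn
  have key := aux_int u hum b d hb hbd
    (by
      intro r hr hrd
      rw [hJ r hr hrd]
      refine Complex.continuous_re.comp (hFd.continuousOn.comp_continuous (continuous_circleMap 0 r) fun θ => ?_)
      simpa [abs_of_pos hr] using hrd)
    (by
      intro r s hr hrs hsd
      have h1 := hJ r hr (by linarith)
      have h2 := hJ s (by linarith) hsd
      have e1 : ∀ θ, u (circleMap 0 r θ) = (F (circleMap 0 r θ)).re := congrFun h1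
      have e2 : ∀ θ, u (circleMap 0 s θ) = (F (circleMap 0 s θ)).re := congrFun h2
      simp_rw [e1, e2]
      exact aux_re_mono F d r s hFd hr hrs hsd)
  rw [auxPhi_lint c _ measurableSet_Iic, auxPhi_lint c _ measurableSet_Ioo]
  have hset : ∀ S : Set ℝ, MeasurableSet S → (∀ x ∈ S, x < d) → ∫⁻ z in {z : ℂ | ‖z‖ ∈ S}, ‖g (auxPhi c z)‖ₑ ^ 2 =
      ∫⁻ z in {z : ℂ | ‖z‖ ∈ S}, ‖u z‖ₑ ^ 2 := by
    intro S hS hSd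
    apply setLIntegral_congr_fun (measurable_norm hS)
    intro z hz
    simp only
    rw [huu z (hSd _ hz)]
  rw [hset _ measurableSet_Iic (fun x hx => lt_of_le_of_lt hx hbd), hset _ measurableSet_Ioo (fun x hx => hx.2)]
  exact key

theorem aux_sq (f : Pt → ℝ) (μ : Measure Pt) : eLpNorm f 2 μ ^ 2 = ∫⁻ x, ‖f x‖ₑ ^ 2 ∂μ := by
  have := eLpNorm_nnreal_pow_eq_lintegral (f := f) (μ := μ) (p := 2) (by norm_num)
  simpa using this

theorem aux_split (p q s : ℝ) (hp : 0 ≤ p) (hq : 0 < q) (hs : q / (p + q) ≤ s) (X Y T : ENNReal)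
    (hT : X + Y ≤ T) (hXY : ENNReal.ofReal p * X ≤ ENNReal.ofReal q * Y) :
    X ≤ ENNReal.ofReal s * T := by
  have hpq : 0 < p + q := by linarith
  have h1 : ENNReal.ofReal (p + q) * X ≤ ENNReal.ofReal q * T := by
    rw [ENNReal.ofReal_add hp hq.le, add_mul]
    calc _ ≤ ENNReal.ofReal q * Y + ENNReal.ofReal q * X := by gcongr
      _ = ENNReal.ofReal q * (X + Y) := by ring
      _ ≤ _ := by gcongr
  have h2 : X ≤ ENNReal.ofReal (q / (p + q)) * T := by
    have h3 : X = ENNReal.ofReal ((p + q)⁻¹) * (ENNReal.ofReal (p + q) * X) := by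
      rw [← mul_assoc, ← ENNReal.ofReal_mul (by positivity), inv_mul_cancel₀ hpq.ne']
      simp
    calc X = ENNReal.ofReal ((p + q)⁻¹) * (ENNReal.ofReal (p + q) * X) := h3
      _ ≤ ENNReal.ofReal ((p + q)⁻¹) * (ENNReal.ofReal q * T) := by gcongr
      _ = _ := by
        rw [← mul_assoc, ← ENNReal.ofReal_mul (by positivity)]
        congr 2
        field_simp
  exact h2.trans (by gcongr)

theorem aux_sqrt_le (s : ℝ) (hs : 0 ≤ s) (x y : ENNReal) (h : x ^ 2 ≤ ENNReal.ofReal s * y ^ 2) :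
    x ≤ ENNReal.ofReal (Real.sqrt s) * y := by
  have : x ^ 2 ≤ (ENNReal.ofReal (Real.sqrt s) * y) ^ 2 := by
    rw [mul_pow, ← ENNReal.ofReal_pow (Real.sqrt_nonneg s), Real.sq_sqrt hs]
    exact h
  exact (ENNReal.pow_right_strictMono (by norm_num : (2:ℕ) ≠ 0)).le_iff_le.1 this

theorem aux_delta {𝒢 𝒪 : Set Pt} {c : Pt} {Re Ri Rp Rm δ δ₀ : ℝ}
    (geom : Geometry 𝒢 𝒪 c Re Ri Rp Rm δ δ₀) : 2 < δ₀ := by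
  have := geom.Rm_pos
  have := geom.Rm_lt_Rp
  have := geom.Rp_lt_Ri
  have h3 := geom.Ri_lt_Re
  rw [geom.δ₀_eq]
  have : 0 < Real.log (Re / Ri) := Real.log_pos (by rw [lt_div_iff₀ (by linarith)]; linarith)
  linarith

theorem aux_A {𝒢 𝒪 : Set Pt} {c : Pt} {Re Ri Rp Rm δ δ₀ : ℝ}
    (geom : Geometry 𝒢 𝒪 c Re Ri Rp Rm δ δ₀)
    (h : Pt → ℝ) (hh : IsHarmonicOn h (closure 𝒪)ᶜ)
    (hlim : Tendsto h (cocompact Pt) (nhds 0)) :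
    eLpNorm h 2 (volume.restrict ((𝒢 \ closure 𝒪) \ closedBall c Rp)) ≤
      ENNReal.ofReal (Real.sqrt (δ₀ / δ)) * eLpNorm h 2 (volume.restrict (𝒢 \ closure 𝒪)) := by
  have hd := aux_delta geom
  have hd2 := geom.δ₀_lt_δ
  have hδ₀p : 0 < δ₀ := by linarith
  have hδp : 0 < δ := by linarith
  have hRm := geom.Rm_pos
  have hmp := geom.Rm_lt_Rp
  have hpi := geom.Rp_lt_Ri
  have hie := geom.Ri_lt_Re
  have key := aux_ext_pt h c _ isClosed_closure.isOpen_compl hh hlim Rm Rp Re hRm hmp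
    (by linarith) (by
      intro x hx hxO
      have := geom.clO_sub hxO
      rw [mem_ball] at this
      linarith)
  have hRe : 0 < Re := by linarith
  have e1 : Real.log (Rp / Rm) = δ ^ 2 - δ := by
    rw [geom.Rm_eq, geom.Rp_eq, mul_div_mul_left _ _ hRe.ne', ← Real.exp_sub, Real.log_exp]
    ring
  have e2 : Real.log (Re / Rp) = δ := by
    rw [geom.Rp_eq, div_mul_eq_div_div, div_self hRe.ne', one_div, ← Real.exp_neg, Real.log_exp]
    ring
  rw [e1, e2] at key
  apply aux_sqrt_le _ (by positivity)
  rw [aux_sq, aux_sq]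
  have hsplit := lintegral_inter_add_sdiff (μ := volume) (fun x => ‖h x‖ₑ ^ 2) (𝒢 \ closure 𝒪)
    (measurableSet_closedBall (x := c) (ε := Rp))
  refine aux_split (δ ^ 2 - δ) δ _ (by nlinarith) (by linarith) ?_ _
    (∫⁻ x in (𝒢 \ closure 𝒪) ∩ closedBall c Rp, ‖h x‖ₑ ^ 2) _ ?_ ?_
  · rw [sub_add_cancel, div_le_div_iff₀ (by positivity) (by linarith)]
    nlinarith
  · rw [add_comm, hsplit]
  · calc _ ≤ ENNReal.ofReal (δ ^ 2 - δ) * ∫⁻ x in {x : Pt | dist x c ∈ Set.Ioc Rp Re}, ‖h x‖ₑ ^ 2 := by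
          gcongr
          rintro x ⟨⟨hx, -⟩, hx2⟩
          have h1 := geom.clG_sub (subset_closure hx)
          rw [mem_ball] at h1
          rw [mem_closedBall, not_le] at hx2
          exact ⟨hx2, h1.le⟩
      _ ≤ _ := key
      _ ≤ _ := by
          gcongr
          rintro x ⟨hx1, hx2⟩
          refine ⟨⟨geom.clDi_sub ?_, ?_⟩, ?_⟩
          · rw [mem_closedBall]; linarith
          · intro hxO
            have := geom.clO_sub hxO
            rw [mem_ball] at this
            linarith
          · rw [mem_closedBall]; exact hx2

open InnerProductSpace in
theorem aux_B {𝒢 𝒪 : Set Pt} {c : Pt} {Re Ri Rp Rm δ δ₀ : ℝ}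
    (geom : Geometry 𝒢 𝒪 c Re Ri Rp Rm δ δ₀)
    (g : Pt → ℝ) (hg : HarmonicOnNhd (fun z => g (auxPhi c z)) (ball 0 Ri)) :
    eLpNorm g 2 (volume.restrict ((𝒢 \ closure 𝒪) ∩ closedBall c Rp)) ≤
      ENNReal.ofReal (Real.sqrt (δ₀ / δ)) * eLpNorm g 2 (volume.restrict (𝒢 \ closure 𝒪)) := by
  have hd := aux_delta geom
  have hd2 := geom.δ₀_lt_δ
  have hδ₀p : 0 < δ₀ := by linarith
  have hδp : 0 < δ := by linarith
  have hRm := geom.Rm_pos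
  have hmp := geom.Rm_lt_Rp
  have hpi := geom.Rp_lt_Ri
  have hie := geom.Ri_lt_Re
  have hRe : 0 < Re := by linarith
  have hRi : 0 < Ri := by linarith
  have hRp : 0 < Rp := by linarith
  have key := aux_int_pt g c Rp Ri (by linarith) hpi hg
  apply aux_sqrt_le _ (by positivity)
  rw [aux_sq, aux_sq]
  have hsplit := lintegral_inter_add_sdiff (μ := volume) (fun x => ‖g x‖ₑ ^ 2) (𝒢 \ closure 𝒪)
    (measurableSet_closedBall (x := c) (ε := Rp))
  refine aux_split (Ri ^ 2 - Rp ^ 2) (Rp ^ 2) _ (by nlinarith) (by positivity) ?_ _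
    (∫⁻ x in (𝒢 \ closure 𝒪) \ closedBall c Rp, ‖g x‖ₑ ^ 2) _ ?_ ?_
  · rw [sub_add_cancel]
    have h1 : Ri = Re * Real.exp (2 - δ₀) := by
      have : Real.log (Re / Ri) = δ₀ - 2 := by rw [geom.δ₀_eq]; ring
      have h2 : Re / Ri = Real.exp (δ₀ - 2) := by rw [← this, Real.exp_log (by positivity)]
      rw [show (2 - δ₀) = -(δ₀ - 2) by ring, Real.exp_neg, ← h2]
      field_simp
    have h2 : Rp = Ri * Real.exp (δ₀ - 2 - δ) := by
      rw [h1, geom.Rp_eq, mul_assoc, ← Real.exp_add]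
      congr 2; ring
    have h3 : Rp ^ 2 / Ri ^ 2 = (Real.exp (2 * (δ - δ₀) + 4))⁻¹ := by
      rw [h2, mul_pow, mul_div_cancel_left₀ _ (by positivity), ← Real.exp_nat_mul, ← Real.exp_neg]
      congr 1; push_cast; ring
    rw [h3, show δ₀ / δ = (δ / δ₀)⁻¹ by rw [inv_div]]
    apply inv_anti₀ (by apply div_pos <;> linarith)
    have h4 := Real.add_one_le_exp (2 * (δ - δ₀) + 4)
    refine le_trans ?_ h4
    rw [div_le_iff₀ (by linarith)]
    nlinarith
  · rw [hsplit]
  · calc _ ≤ ENNReal.ofReal (Ri ^ 2 - Rp ^ 2) * ∫⁻ x in {x : Pt | dist x c ∈ Set.Iic Rp}, ‖g x‖ₑ ^ 2 := by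
          gcongr
          rintro x ⟨-, hx2⟩
          exact hx2
      _ ≤ _ := key
      _ ≤ _ := by
          gcongr
          rintro x ⟨hx1, hx2⟩
          refine ⟨⟨geom.clDi_sub ?_, ?_⟩, ?_⟩
          · rw [mem_closedBall]; linarith
          · intro hxO
            have := geom.clO_sub hxO
            rw [mem_ball] at this
            linarith
          · rw [mem_closedBall]; linarith

open InnerProductSpace in
theorem aux_span {𝒢 𝒪 : Set Pt} {c : Pt} {Re Ri Rp Rm δ δ₀ : ℝ}
    (geom : Geometry 𝒢 𝒪 c Re Ri Rp Rm δ δ₀) (f : Lp ℝ 2 (volume.restrict (𝒢 \ closure 𝒪)))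
    (hf : f ∈ Submodule.span ℝ {f : Lp ℝ 2 (volume.restrict (𝒢 \ closure 𝒪)) |
      ∃ g : Pt → ℝ, IsHarmonicOn g 𝒢 ∧ IntegrableOn (fun x => g x ^ 2) 𝒢 ∧
        (f : Pt → ℝ) =ᵐ[volume.restrict (𝒢 \ closure 𝒪)] g}) :
    ∃ g : Pt → ℝ, HarmonicOnNhd (fun z => g (auxPhi c z)) (ball 0 Ri) ∧
      (f : Pt → ℝ) =ᵐ[volume.restrict (𝒢 \ closure 𝒪)] g := by
  induction hf using Submodule.span_induction with
  | mem f hf =>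
    obtain ⟨g, hg, -, hfg⟩ := hf
    refine ⟨g, (aux_transfer g 𝒢 geom.openG c hg).mono ?_, hfg⟩
    intro z hz
    apply geom.clDi_sub
    rw [mem_closedBall, auxPhi_dist]
    exact le_of_lt (by simpa using hz)
  | zero =>
    refine ⟨fun _ => 0, ?_, Lp.coeFn_zero _ _ _⟩
    intro z _
    exact ⟨contDiffAt_const, by simp [laplacian_const]⟩
  | add x y _ _ hx hy =>
    obtain ⟨g1, h1, e1⟩ := hx
    obtain ⟨g2, h2, e2⟩ := hy
    exact ⟨g1 + g2, h1.add h2, (Lp.coeFn_add x y).trans (e1.add e2)⟩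
  | smul a x _ hx =>
    obtain ⟨g1, h1, e1⟩ := hx
    exact ⟨a • g1, h1.const_smul, (Lp.coeFn_smul a x).trans (e1.const_smul a)⟩

theorem aux_cs (f g : Pt → ℝ) (S : Set Pt) (hf : AEStronglyMeasurable f (volume.restrict S))
    (hg : AEStronglyMeasurable g (volume.restrict S)) :
    ∫⁻ x in S, ‖f x * g x‖ₑ ≤ eLpNorm f 2 (volume.restrict S) * eLpNorm g 2 (volume.restrict S) := by
  have := eLpNorm_smul_le_mul_eLpNorm (p := 2) (q := 2) (r := 1) hg hf
  rw [eLpNorm_one_eq_lintegral_enorm] at this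
  exact this

theorem aux_inner {𝒢 𝒪 : Set Pt} {c : Pt} {Re Ri Rp Rm δ δ₀ : ℝ}
    (geom : Geometry 𝒢 𝒪 c Re Ri Rp Rm δ δ₀)
    (h : Pt → ℝ) (hh : IsHarmonicOn h (closure 𝒪)ᶜ)
    (hlim : Tendsto h (cocompact Pt) (nhds 0))
    (hmem : MemLp h 2 (volume.restrict (𝒢 \ closure 𝒪)))
    (f : Lp ℝ 2 (volume.restrict (𝒢 \ closure 𝒪)))
    (hf : f ∈ HGclosure 𝒢 (𝒢 \ closure 𝒪)) :
    |inner ℝ (hmem.toLp h) f| ≤ 2 * Real.sqrt (δ₀ / δ) * ‖hmem.toLp h‖ * ‖f‖ := by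
  have hcl : IsClosed {f : Lp ℝ 2 (volume.restrict (𝒢 \ closure 𝒪)) |
      |inner ℝ (hmem.toLp h) f| ≤ 2 * Real.sqrt (δ₀ / δ) * ‖hmem.toLp h‖ * ‖f‖} :=
    isClosed_le (by fun_prop) (by fun_prop)
  refine closure_minimal ?_ hcl hf
  intro f hf
  obtain ⟨g, hg, hfg⟩ := aux_span geom f hf
  have hA := aux_A geom h hh hlim
  have hB := aux_B geom g hg
  have hgm : MemLp g 2 (volume.restrict (𝒢 \ closure 𝒪)) := (memLp_congr_ae hfg).1 (Lp.memLp f)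
  have hnf : eLpNorm g 2 (volume.restrict (𝒢 \ closure 𝒪)) = ENNReal.ofReal ‖f‖ := by
    rw [← eLpNorm_congr_ae hfg, Lp.norm_def, ENNReal.ofReal_toReal (Lp.eLpNorm_ne_top f)]
  have hnh : eLpNorm h 2 (volume.restrict (𝒢 \ closure 𝒪)) = ENNReal.ofReal ‖hmem.toLp h‖ := by
    rw [Lp.norm_toLp, ENNReal.ofReal_toReal hmem.2.ne]
  have hin : inner ℝ (hmem.toLp h) f = ∫ x in (𝒢 \ closure 𝒪), h x * g x := by
    rw [L2.inner_def]
    apply integral_congr_ae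
    filter_upwards [hfg, hmem.coeFn_toLp] with x h1 h2
    rw [h1, h2]
    simp [mul_comm]
  have hsplit := lintegral_inter_add_sdiff (μ := volume) (fun x => ‖h x * g x‖ₑ) (𝒢 \ closure 𝒪)
    (measurableSet_closedBall (x := c) (ε := Rp))
  have m1 := hmem.1
  have m2 := hgm.1
  have s1 : (𝒢 \ closure 𝒪) ∩ closedBall c Rp ⊆ 𝒢 \ closure 𝒪 := Set.inter_subset_left
  have s2 : (𝒢 \ closure 𝒪) \ closedBall c Rp ⊆ 𝒢 \ closure 𝒪 := Set.sdiff_subset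
  have hmain : ‖(inner ℝ (hmem.toLp h) f : ℝ)‖ₑ ≤
      ENNReal.ofReal (2 * Real.sqrt (δ₀ / δ) * ‖hmem.toLp h‖ * ‖f‖) := by
    rw [hin]
    refine (enorm_integral_le_lintegral_enorm _).trans ?_
    rw [← hsplit]
    calc _ ≤ eLpNorm h 2 (volume.restrict ((𝒢 \ closure 𝒪) ∩ closedBall c Rp)) *
            eLpNorm g 2 (volume.restrict ((𝒢 \ closure 𝒪) ∩ closedBall c Rp)) +
            eLpNorm h 2 (volume.restrict ((𝒢 \ closure 𝒪) \ closedBall c Rp)) *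
            eLpNorm g 2 (volume.restrict ((𝒢 \ closure 𝒪) \ closedBall c Rp)) :=
          add_le_add (aux_cs h g _ (m1.mono_set s1) (m2.mono_set s1))
            (aux_cs h g _ (m1.mono_set s2) (m2.mono_set s2))
      _ ≤ ENNReal.ofReal ‖hmem.toLp h‖ * (ENNReal.ofReal (Real.sqrt (δ₀ / δ)) * ENNReal.ofReal ‖f‖) +
          (ENNReal.ofReal (Real.sqrt (δ₀ / δ)) * ENNReal.ofReal ‖hmem.toLp h‖) * ENNReal.ofReal ‖f‖ := by
          rw [← hnf, ← hnh]
          refine add_le_add (mul_le_mul' ?_ hB) (mul_le_mul' hA ?_)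
          · exact eLpNorm_mono_measure _ (Measure.restrict_mono s1 le_rfl)
          · exact eLpNorm_mono_measure _ (Measure.restrict_mono s2 le_rfl)
      _ = _ := by
          rw [ENNReal.ofReal_mul (by positivity), ENNReal.ofReal_mul (by positivity),
            ENNReal.ofReal_mul (by positivity), ENNReal.ofReal_ofNat]
          ring
  rw [Real.enorm_eq_ofReal_abs] at hmain
  exact (ENNReal.ofReal_le_ofReal_iff (by positivity)).1 hmain

theorem stmt15 (𝒢 𝒪 : Set Pt) (c : Pt) (Re Ri Rp Rm δ δ₀ : ℝ)
    (geom : Geometry 𝒢 𝒪 c Re Ri Rp Rm δ δ₀)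
    (h : Pt → ℝ) (hh : IsHarmonicOn h (closure 𝒪)ᶜ)
    (hloc : LocallyIntegrableOn (fun x => h x ^ 2) (closure 𝒪)ᶜ)
    (hlim : Tendsto h (cocompact Pt) (nhds 0))
    (hmem : MemLp h 2 (volume.restrict (𝒢 \ closure 𝒪))) :
    eLpNorm
        (fun x => h x -
          ((Submodule.orthogonalProjectionOnto (HGclosure 𝒢 (𝒢 \ closure 𝒪)) (hmem.toLp h) :
              Lp ℝ 2 (volume.restrict (𝒢 \ closure 𝒪))) : Pt → ℝ) x)
        2 (volume.restrict ((𝒢 \ closure 𝒪) \ closedBall c Rp))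
        ≤ ENNReal.ofReal (3 * Real.sqrt (δ₀ / δ)) * ENNReal.ofReal ‖hmem.toLp h‖
      ∧ (4 * δ₀ < δ →
          eLpNorm
            (fun x => h x -
              ((Submodule.orthogonalProjectionOnto (HGclosure 𝒢 (𝒢 \ closure 𝒪)) (hmem.toLp h) :
                  Lp ℝ 2 (volume.restrict (𝒢 \ closure 𝒪))) : Pt → ℝ) x)
            2 (volume.restrict ((𝒢 \ closure 𝒪) \ closedBall c Rp))
          ≤ ENNReal.ofReal (3 * Real.sqrt (δ₀ / (δ - 4 * δ₀)))
              * ENNReal.ofReal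
                  ‖hmem.toLp h
                    - (Submodule.orthogonalProjectionOnto (HGclosure 𝒢 (𝒢 \ closure 𝒪)) (hmem.toLp h) :
                        Lp ℝ 2 (volume.restrict (𝒢 \ closure 𝒪)))‖) := by
  have hd := aux_delta geom
  have hd2 := geom.δ₀_lt_δ
  have hδ₀p : 0 < δ₀ := by linarith
  have hδp : 0 < δ := by linarith
  have hinner := aux_inner geom h hh hlim hmem
    (Submodule.orthogonalProjectionOnto (HGclosure 𝒢 (𝒢 \ closure 𝒪)) (hmem.toLp h) :
              Lp ℝ 2 (volume.restrict (𝒢 \ closure 𝒪))) (Submodule.coe_mem _)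
  have horth : inner ℝ (hmem.toLp h -
      (Submodule.orthogonalProjectionOnto (HGclosure 𝒢 (𝒢 \ closure 𝒪)) (hmem.toLp h) :
              Lp ℝ 2 (volume.restrict (𝒢 \ closure 𝒪))))
      (Submodule.orthogonalProjectionOnto (HGclosure 𝒢 (𝒢 \ closure 𝒪)) (hmem.toLp h) :
              Lp ℝ 2 (volume.restrict (𝒢 \ closure 𝒪))) = 0 :=
    Submodule.starProjection_inner_eq_zero _ _ (Submodule.coe_mem _)
  have hA := aux_A geom h hh hlim
  have hnh : eLpNorm h 2 (volume.restrict (𝒢 \ closure 𝒪)) = ENNReal.ofReal ‖hmem.toLp h‖ := by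
    rw [Lp.norm_toLp, ENNReal.ofReal_toReal hmem.2.ne]
  rw [hnh] at hA
  generalize (Submodule.orthogonalProjectionOnto (HGclosure 𝒢 (𝒢 \ closure 𝒪)) (hmem.toLp h) :
              Lp ℝ 2 (volume.restrict (𝒢 \ closure 𝒪))) = p at *
  generalize hmem.toLp h = H at *
  have hs0 : 0 ≤ Real.sqrt (δ₀ / δ) := Real.sqrt_nonneg _
  have hs2 : Real.sqrt (δ₀ / δ) ^ 2 = δ₀ / δ := Real.sq_sqrt (by positivity)
  have hpp : inner ℝ H p = ‖p‖ ^ 2 := by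
    rw [inner_sub_left, real_inner_self_eq_norm_sq] at horth
    linarith
  have hp : ‖p‖ ≤ 2 * Real.sqrt (δ₀ / δ) * ‖H‖ := by
    rcases (norm_nonneg p).eq_or_lt with h0 | h0
    · rw [← h0]; positivity
    · have := (le_abs_self _).trans hinner
      rw [hpp, sq] at this
      exact le_of_mul_le_mul_right this h0
  have hpn : eLpNorm p 2 (volume.restrict (𝒢 \ closure 𝒪)) = ENNReal.ofReal ‖p‖ := by
    rw [Lp.norm_def, ENNReal.ofReal_toReal (Lp.eLpNorm_ne_top p)]
  have s2 : (𝒢 \ closure 𝒪) \ closedBall c Rp ⊆ 𝒢 \ closure 𝒪 := Set.sdiff_subset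
  have first : eLpNorm (fun x => h x - p x) 2 (volume.restrict ((𝒢 \ closure 𝒪) \ closedBall c Rp))
      ≤ ENNReal.ofReal (3 * Real.sqrt (δ₀ / δ)) * ENNReal.ofReal ‖H‖ := by
    calc _ ≤ eLpNorm h 2 (volume.restrict ((𝒢 \ closure 𝒪) \ closedBall c Rp)) +
          eLpNorm p 2 (volume.restrict ((𝒢 \ closure 𝒪) \ closedBall c Rp)) :=
          eLpNorm_sub_le (hmem.1.mono_set s2) ((Lp.aestronglyMeasurable p).mono_set s2) (by norm_num)
      _ ≤ ENNReal.ofReal (Real.sqrt (δ₀ / δ)) * ENNReal.ofReal ‖H‖ +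
          ENNReal.ofReal (2 * Real.sqrt (δ₀ / δ) * ‖H‖) := by
          refine add_le_add hA ?_
          refine (eLpNorm_mono_measure _ (Measure.restrict_mono s2 le_rfl)).trans ?_
          rw [hpn]
          exact ENNReal.ofReal_le_ofReal hp
      _ = _ := by
          rw [← ENNReal.ofReal_mul hs0, ← ENNReal.ofReal_mul (by positivity),
            ← ENNReal.ofReal_add (by positivity) (by positivity)]
          congr 1
          ring
  refine ⟨first, fun h4 => first.trans ?_⟩
  rw [← ENNReal.ofReal_mul (by positivity), ← ENNReal.ofReal_mul (by positivity)]
  apply ENNReal.ofReal_le_ofReal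
  rw [mul_assoc, mul_assoc]
  refine mul_le_mul_of_nonneg_left ?_ (by norm_num)
  have hδ : 0 < δ := by linarith
  have hδ4 : 0 < δ - 4 * δ₀ := by linarith
  have hpyth : ‖H - p‖ ^ 2 = ‖H‖ ^ 2 - ‖p‖ ^ 2 := by
    rw [norm_sub_sq_real, hpp]; ring
  have hpsq : ‖p‖ ^ 2 ≤ 4 * (δ₀ / δ) * ‖H‖ ^ 2 := by
    calc ‖p‖ ^ 2 ≤ (2 * Real.sqrt (δ₀ / δ) * ‖H‖) ^ 2 := by gcongr
      _ = _ := by rw [mul_pow, mul_pow, hs2]; ring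
  have h5 : Real.sqrt (δ₀ / (δ - 4 * δ₀)) ^ 2 = δ₀ / (δ - 4 * δ₀) := Real.sq_sqrt (by positivity)
  apply le_of_sq_le_sq _ (by positivity)
  rw [mul_pow, mul_pow, hs2, h5, hpyth]
  have h6 : (δ - 4 * δ₀) / δ * ‖H‖ ^ 2 ≤ ‖H‖ ^ 2 - ‖p‖ ^ 2 := by
    have : (δ - 4 * δ₀) / δ * ‖H‖ ^ 2 = ‖H‖ ^ 2 - 4 * (δ₀ / δ) * ‖H‖ ^ 2 := by
      field_simp
    linarith
  calc δ₀ / δ * ‖H‖ ^ 2 = δ₀ / (δ - 4 * δ₀) * ((δ - 4 * δ₀) / δ * ‖H‖ ^ 2) := by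
        rw [← mul_assoc, div_mul_div_cancel₀ hδ4.ne']
    _ ≤ _ := by gcongr
end
end
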